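/- Fix d ≥ 1, T > 0, a compact interval Θ = [θ_min, θ_max] ⊂ (0,∞), a link function Φ, a smooth ℤ^d-periodic initial value u_0, an integer β > 2 + d/2, and R > 0. There exists a constant D = D(R) > 0 such that: for every θ ∈ Θ and all smooth ℤ^d-periodic F, F₀ with ‖F‖_{H^β(𝕋^d)} ≤ R and ‖F₀‖_{H^β(𝕋^d)} ≤ R, if u_{θ,F}, u_{θ,F₀} are smooth classical solutions with absorptions Φ∘F, Φ∘F₀, diffusivity θ and initial value u_0, and w_{θ,F}, w_{θ,F₀} are the associated θ-derivative solutions, then ‖w_{θ,F} − w_{θ,F₀}‖_{H^{2,1}(Q)} ≤ D ‖F − F₀‖_{L²(𝕋^d)} (1 + ‖F‖_∞). (Lemma 'bounds', item (iv): Lipschitz dependence of K̇_θF on F.) -/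

import Mathlib

open MeasureTheory Real Filter

noncomputable section

/-- Partial derivative in the `i`-th spatial coordinate. -/
def pder {d : ℕ} (i : Fin d) (v : (Fin d → ℝ) → ℝ) : (Fin d → ℝ) → ℝ :=
  fun x => deriv (fun s => v (Function.update x i s)) (x i)

/-- Spatial Laplacian `Δ_x = ∑ᵢ ∂²/∂xᵢ²`. -/
def lap {d : ℕ} (v : (Fin d → ℝ) → ℝ) : (Fin d → ℝ) → ℝ :=
  fun x => ∑ i : Fin d, pder i (pder i v) x

/-- Multi-index spatial derivative `∂^j`. -/
def mder {d : ℕ} (j : Fin d → ℕ) (v : (Fin d → ℝ) → ℝ) : (Fin d → ℝ) → ℝ :=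
  (List.finRange d).foldr (fun i acc => (pder i)^[j i] acc) v

/-- `ℤ^d`-periodicity of a function on `ℝ^d`. -/
def ZPer {d : ℕ} (F : (Fin d → ℝ) → ℝ) : Prop :=
  ∀ (x : Fin d → ℝ) (k : Fin d → ℤ), F (fun i => x i + (k i : ℝ)) = F x

/-- `ℤ^d`-periodicity in the space variable. -/
def ZPerSpace {d : ℕ} (u : (Fin d → ℝ) → ℝ → ℝ) : Prop :=
  ∀ t : ℝ, ZPer fun x => u x t

/-- The fundamental domain `[0,1]^d` of the torus. -/
def unitCube (d : ℕ) : Set (Fin d → ℝ) := Set.Icc 0 1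

/-- `L²`-norm on the torus. -/
def l2T {d : ℕ} (F : (Fin d → ℝ) → ℝ) : ℝ :=
  Real.sqrt (∫ x in unitCube d, (F x) ^ 2)

/-- `L²`-norm on `Q = 𝕋^d × (0,T)`. -/
def l2Q {d : ℕ} (T : ℝ) (u : (Fin d → ℝ) → ℝ → ℝ) : ℝ :=
  Real.sqrt (∫ t in Set.Ioc (0 : ℝ) T, ∫ x in unitCube d, (u x t) ^ 2)

/-- Supremum norm over space. -/
def supT {d : ℕ} (F : (Fin d → ℝ) → ℝ) : ℝ := ⨆ x, |F x|

/-- Supremum norm over `𝕋^d × [0,T]`. -/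
def supQ {d : ℕ} (T : ℝ) (u : (Fin d → ℝ) → ℝ → ℝ) : ℝ :=
  ⨆ x, ⨆ t ∈ Set.Icc (0 : ℝ) T, |u x t|

/-- Squared Sobolev `H^β`-norm on the torus:  `∑_{|j| ≤ β} ‖∂^j F‖²_{L²(𝕋^d)}`. -/
def hSobSq {d : ℕ} (β : ℕ) (F : (Fin d → ℝ) → ℝ) : ℝ :=
  ∑ j ∈ Finset.univ.filter (fun j : Fin d → Fin (β + 1) => (∑ i, (j i : ℕ)) ≤ β),
    ∫ x in unitCube d, (mder (fun i => (j i : ℕ)) F x) ^ 2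

/-- Sobolev `H^β`-norm on the torus. -/
def hSob {d : ℕ} (β : ℕ) (F : (Fin d → ℝ) → ℝ) : ℝ := Real.sqrt (hSobSq β F)

/-- Squared parabolic Sobolev `H^{2,1}(Q)`-norm. -/
def h21Sq {d : ℕ} (T : ℝ) (u : (Fin d → ℝ) → ℝ → ℝ) : ℝ :=
  (∫ t in Set.Ioc (0 : ℝ) T,
      ∑ j ∈ Finset.univ.filter (fun j : Fin d → Fin 3 => (∑ i, (j i : ℕ)) ≤ 2),
        ∫ x in unitCube d, (mder (fun i => (j i : ℕ)) (fun y => u y t) x) ^ 2)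
    + ∫ x in unitCube d, ∫ t in Set.Ioc (0 : ℝ) T, ((u x t) ^ 2 + (deriv (u x) t) ^ 2)

/-- Parabolic Sobolev `H^{2,1}(Q)`-norm. -/
def h21 {d : ℕ} (T : ℝ) (u : (Fin d → ℝ) → ℝ → ℝ) : ℝ := Real.sqrt (h21Sq T u)

/-- Smoothness of a function of space and time. -/
def SmoothQ {d : ℕ} (u : (Fin d → ℝ) → ℝ → ℝ) : Prop :=
  ContDiff ℝ (⊤ : ℕ∞) fun p : (Fin d → ℝ) × ℝ => u p.1 p.2

/-- A smooth classical solution of the heat equation with absorption `f`,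
diffusivity `θ` and initial value `u0`. -/
def HeatSol {d : ℕ} (T θ : ℝ) (f u0 : (Fin d → ℝ) → ℝ) (u : (Fin d → ℝ) → ℝ → ℝ) : Prop :=
  SmoothQ u ∧ ZPerSpace u ∧
    (∀ (x : Fin d → ℝ), ∀ t ∈ Set.Ioc (0 : ℝ) T,
      deriv (u x) t = θ / 2 * lap (fun y => u y t) x - f x * u x t) ∧
    ∀ x, u x 0 = u0 x

/-- A smooth solution of the inhomogeneous problem with forcing `g` and
zero initial value (`v = 𝓛_{θ,f}⁻¹ g`). -/
def InhomSol {d : ℕ} (T θ : ℝ) (f : (Fin d → ℝ) → ℝ) (g v : (Fin d → ℝ) → ℝ → ℝ) : Prop :=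
  SmoothQ v ∧ ZPerSpace v ∧
    (∀ (x : Fin d → ℝ), ∀ t ∈ Set.Ioc (0 : ℝ) T,
      deriv (v x) t = θ / 2 * lap (fun y => v y t) x - f x * v x t + g x t) ∧
    ∀ x, v x 0 = 0

/-- A link function: a smooth function `Φ : ℝ → (fmin, ∞)` with strictly positive
derivative and all derivatives bounded. -/
structure LinkFun where
  toFun : ℝ → ℝ
  fmin : ℝ
  fmin_pos : 0 < fmin
  smooth : ContDiff ℝ (⊤ : ℕ∞) toFun
  gt_fmin : ∀ x, fmin < toFun x
  deriv_pos : ∀ x, 0 < deriv toFun x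
  derivs_bdd : ∀ n : ℕ, 1 ≤ n → ∃ C, ∀ x, |iteratedDeriv n toFun x| ≤ C

/-- The linearized solution `I_{θ,F} h` in direction `h`, associated with a solution `u`. -/
def LinSol {d : ℕ} (T θ : ℝ) (Φ : LinkFun) (F h : (Fin d → ℝ) → ℝ)
    (u z : (Fin d → ℝ) → ℝ → ℝ) : Prop :=
  SmoothQ z ∧ ZPerSpace z ∧
    (∀ (x : Fin d → ℝ), ∀ t ∈ Set.Ioc (0 : ℝ) T,
      deriv (z x) t = θ / 2 * lap (fun y => z y t) x - Φ.toFun (F x) * z x t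
        + h x * deriv Φ.toFun (F x) * u x t) ∧
    ∀ x, z x 0 = 0

/-- The `θ`-derivative solution `K̇_θ F`, associated with a solution `u`. -/
def ThetaDerivSol {d : ℕ} (T θ : ℝ) (Φ : LinkFun) (F : (Fin d → ℝ) → ℝ)
    (u w : (Fin d → ℝ) → ℝ → ℝ) : Prop :=
  SmoothQ w ∧ ZPerSpace w ∧
    (∀ (x : Fin d → ℝ), ∀ t ∈ Set.Ioc (0 : ℝ) T,
      deriv (w x) t = θ / 2 * lap (fun y => w y t) x - Φ.toFun (F x) * w x t
        + 1 / 2 * lap (fun y => u y t) x) ∧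
    ∀ x, w x 0 = 0

/-- Dual Sobolev norm `‖G‖_{(H²)*}` on the torus. -/
def h2dual {d : ℕ} (G : (Fin d → ℝ) → ℝ) : ℝ :=
  sSup {r : ℝ | ∃ g : (Fin d → ℝ) → ℝ, ContDiff ℝ (⊤ : ℕ∞) g ∧ ZPer g ∧ hSob 2 g ≤ 1 ∧
    r = |∫ x in unitCube d, G x * g x|}

end

open scoped ContDiff

noncomputable section PartialDerivatives

variable {d : ℕ}

/-- Spatial partial derivative of a function of space and time. -/
def dx (i : Fin d) (u : (Fin d → ℝ) → ℝ → ℝ) : (Fin d → ℝ) → ℝ → ℝ :=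
  fun x t => pder i (fun y => u y t) x

/-- Time derivative of a function of space and time. -/
def dt (u : (Fin d → ℝ) → ℝ → ℝ) : (Fin d → ℝ) → ℝ → ℝ :=
  fun x t => deriv (u x) t

/-- Spatial Laplacian of a function of space and time. -/
def lapQ (u : (Fin d → ℝ) → ℝ → ℝ) : (Fin d → ℝ) → ℝ → ℝ :=
  fun x t => ∑ i, dx i (dx i u) x t

theorem hasDerivAt_pder {v : (Fin d → ℝ) → ℝ} (hv : Differentiable ℝ v) (i : Fin d)
    (x : Fin d → ℝ) :
    HasDerivAt (fun s => v (Function.update x i s)) (pder i v x) (x i) := by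
  have h : DifferentiableAt ℝ (fun s => v (Function.update x i s)) (x i) :=
    (hv _).comp (x i) (hasDerivAt_update x i (x i)).differentiableAt
  exact h.hasDerivAt

theorem pder_eq_fderiv {v : (Fin d → ℝ) → ℝ} (hv : Differentiable ℝ v) (i : Fin d)
    (x : Fin d → ℝ) : pder i v x = fderiv ℝ v x (Pi.single i 1) := by
  have h := (hv (Function.update x i (x i))).hasFDerivAt.comp_hasDerivAt (x i)
    (hasDerivAt_update x i (x i))
  rw [Function.update_eq_self] at h
  exact h.deriv

theorem ContDiff.pder {v : (Fin d → ℝ) → ℝ} (hv : ContDiff ℝ ∞ v) (i : Fin d) :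
    ContDiff ℝ ∞ (pder i v) := by
  have h : _root_.pder i v = fun x => fderiv ℝ v x (Pi.single i 1) :=
    funext (pder_eq_fderiv (hv.differentiable (by simp)) i)
  rw [h]
  exact (hv.fderiv_right (by simp)).clm_apply contDiff_const

theorem ZPer.pder {v : (Fin d → ℝ) → ℝ} (hv : ZPer v) (i : Fin d) : ZPer (pder i v) := by
  intro x k
  have h : (fun s => v (Function.update (fun j => x j + (k j : ℝ)) i s))
      = fun s => v (Function.update x i (s - k i)) := by
    funext s
    rw [← hv (Function.update x i (s - k i)) k]
    congr 1
    funext j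
    by_cases hj : j = i
    · subst hj; simp
    · simp [hj]
  simp only [_root_.pder, h]
  rw [deriv_comp_sub_const (f := fun s => v (Function.update x i s))]
  simp

/-- Directional derivatives of smooth functions commute. -/
theorem fderiv_fderiv_apply_comm {E : Type*} [NormedAddCommGroup E] [NormedSpace ℝ E]
    {v : E → ℝ} (hv : ContDiff ℝ ∞ v) (a b x : E) :
    fderiv ℝ (fun y => fderiv ℝ v y a) x b = fderiv ℝ (fun y => fderiv ℝ v y b) x a := by
  have h1 : DifferentiableAt ℝ (fderiv ℝ v) x :=
    (hv.fderiv_right (m := ∞) (by simp)).differentiable (by simp) x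
  have hs : IsSymmSndFDerivAt ℝ v x := hv.contDiffAt.isSymmSndFDerivAt (by
    simpa using WithTop.coe_le_coe.2 (le_top : (2 : ℕ∞) ≤ ⊤))
  have key : ∀ c e, fderiv ℝ (fun y => fderiv ℝ v y c) x e = fderiv ℝ (fderiv ℝ v) x e c := by
    intro c e
    rw [fderiv_clm_apply h1 (differentiableAt_const c)]
    simp
  rw [key, key, hs.eq]

theorem pder_comm {v : (Fin d → ℝ) → ℝ} (hv : ContDiff ℝ ∞ v) (i k : Fin d) :
    pder i (pder k v) = pder k (pder i v) := by
  have h : ∀ j, pder j v = fun x => fderiv ℝ v x (Pi.single j 1) := fun j =>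
    funext (pder_eq_fderiv (hv.differentiable (by simp)) j)
  funext x
  rw [pder_eq_fderiv ((hv.pder k).differentiable (by simp)),
    pder_eq_fderiv ((hv.pder i).differentiable (by simp)), h, h, fderiv_fderiv_apply_comm hv]

theorem pder_mul {v w : (Fin d → ℝ) → ℝ} (hv : Differentiable ℝ v) (hw : Differentiable ℝ w)
    (i : Fin d) (x : Fin d → ℝ) :
    pder i (fun y => v y * w y) x = pder i v x * w x + v x * pder i w x := by
  have h := ((hasDerivAt_pder hv i x).mul (hasDerivAt_pder hw i x)).deriv
  simp only [Function.update_eq_self] at h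
  exact h

theorem pder_add {v w : (Fin d → ℝ) → ℝ} (hv : Differentiable ℝ v) (hw : Differentiable ℝ w)
    (i : Fin d) (x : Fin d → ℝ) :
    pder i (fun y => v y + w y) x = pder i v x + pder i w x :=
  ((hasDerivAt_pder hv i x).add (hasDerivAt_pder hw i x)).deriv

theorem pder_sub {v w : (Fin d → ℝ) → ℝ} (hv : Differentiable ℝ v) (hw : Differentiable ℝ w)
    (i : Fin d) (x : Fin d → ℝ) :
    pder i (fun y => v y - w y) x = pder i v x - pder i w x :=
  ((hasDerivAt_pder hv i x).sub (hasDerivAt_pder hw i x)).deriv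

theorem pder_neg (v : (Fin d → ℝ) → ℝ) (i : Fin d) (x : Fin d → ℝ) :
    pder i (fun y => -v y) x = -pder i v x := by
  simp [pder, deriv.fun_neg]

theorem pder_const_mul (c : ℝ) (v : (Fin d → ℝ) → ℝ) (i : Fin d) (x : Fin d → ℝ) :
    pder i (fun y => c * v y) x = c * pder i v x := by
  simp [pder, deriv_const_mul_field]

theorem pder_sum {ι : Type*} (s : Finset ι) {v : ι → (Fin d → ℝ) → ℝ}
    (hv : ∀ k ∈ s, Differentiable ℝ (v k)) (i : Fin d) (x : Fin d → ℝ) :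
    pder i (fun y => ∑ k ∈ s, v k y) x = ∑ k ∈ s, pder i (v k) x :=
  (HasDerivAt.fun_sum fun k hk => hasDerivAt_pder (hv k hk) i x).deriv

theorem pder_comp {Ψ : ℝ → ℝ} {v : (Fin d → ℝ) → ℝ} (hΨ : Differentiable ℝ Ψ)
    (hv : Differentiable ℝ v) (i : Fin d) (x : Fin d → ℝ) :
    pder i (fun y => Ψ (v y)) x = deriv Ψ (v x) * pder i v x := by
  have h := ((hΨ (v (Function.update x i (x i)))).hasDerivAt.comp (x i)
    (hasDerivAt_pder hv i x)).deriv
  simp only [Function.update_eq_self] at h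
  exact h

variable {u : (Fin d → ℝ) → ℝ → ℝ}

theorem SmoothQ.space (hu : SmoothQ u) (t : ℝ) : ContDiff ℝ ∞ fun x => u x t :=
  ContDiff.comp hu (contDiff_id.prodMk contDiff_const)

theorem SmoothQ.time (hu : SmoothQ u) (x : Fin d → ℝ) : ContDiff ℝ ∞ (u x) :=
  ContDiff.comp (g := fun p : (Fin d → ℝ) × ℝ => u p.1 p.2) hu (contDiff_const.prodMk contDiff_id)

theorem SmoothQ.space_differentiable (hu : SmoothQ u) (t : ℝ) :
    Differentiable ℝ fun x => u x t := (hu.space t).differentiable (by simp)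

theorem SmoothQ.hasDerivAt_dt (hu : SmoothQ u) (x : Fin d → ℝ) (t : ℝ) :
    HasDerivAt (u x) (dt u x t) t :=
  ((hu.time x).differentiable (by simp) t).hasDerivAt

theorem SmoothQ.dx_eq_fderiv (hu : SmoothQ u) (i : Fin d) (x : Fin d → ℝ) (t : ℝ) :
    dx i u x t = fderiv ℝ (fun p : (Fin d → ℝ) × ℝ => u p.1 p.2) (x, t) (Pi.single i 1, 0) := by
  have h := HasFDerivAt.comp (g := fun p : (Fin d → ℝ) × ℝ => u p.1 p.2)
    (f := fun y => (y, t)) x ((hu.differentiable (by simp)) (x, t)).hasFDerivAt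
    ((hasFDerivAt_id x).prodMk (hasFDerivAt_const t x))
  rw [dx, pder_eq_fderiv (hu.space_differentiable t)]
  have := h.fderiv
  simp only [Function.comp_def] at this
  rw [this]
  simp

theorem SmoothQ.dt_eq_fderiv (hu : SmoothQ u) (x : Fin d → ℝ) (t : ℝ) :
    dt u x t = fderiv ℝ (fun p : (Fin d → ℝ) × ℝ => u p.1 p.2) (x, t) (0, 1) :=
  (((hu.differentiable (by simp)) (x, t)).hasFDerivAt.comp_hasDerivAt t
    ((hasDerivAt_const t x).prodMk (hasDerivAt_id t))).deriv

theorem SmoothQ.dx (hu : SmoothQ u) (i : Fin d) : SmoothQ (dx i u) := by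
  unfold SmoothQ
  simp only [hu.dx_eq_fderiv]
  exact (ContDiff.fderiv_right hu (by simp)).clm_apply contDiff_const

theorem SmoothQ.dt (hu : SmoothQ u) : SmoothQ (dt u) := by
  unfold SmoothQ
  simp only [hu.dt_eq_fderiv]
  exact (ContDiff.fderiv_right hu (by simp)).clm_apply contDiff_const

theorem SmoothQ.dt_dx (hu : SmoothQ u) (i : Fin d) (x : Fin d → ℝ) (t : ℝ) :
    _root_.dt (_root_.dx i u) x t = _root_.dx i (_root_.dt u) x t := by
  rw [(hu.dx i).dt_eq_fderiv, hu.dt.dx_eq_fderiv]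
  simp only [hu.dx_eq_fderiv, hu.dt_eq_fderiv]
  exact fderiv_fderiv_apply_comm hu _ _ _

theorem SmoothQ.lapQ (hu : SmoothQ u) : SmoothQ (lapQ u) :=
  ContDiff.sum fun i _ => (hu.dx i).dx i

theorem SmoothQ.continuous (hu : SmoothQ u) :
    Continuous fun p : (Fin d → ℝ) × ℝ => u p.1 p.2 := ContDiff.continuous hu

theorem SmoothQ.of_space {f : (Fin d → ℝ) → ℝ} (hf : ContDiff ℝ ∞ f) :
    SmoothQ fun x (_ : ℝ) => f x := ContDiff.comp hf contDiff_fst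

theorem ZPerSpace.dx (hu : ZPerSpace u) (i : Fin d) : ZPerSpace (dx i u) :=
  fun t => (hu t).pder i

theorem ZPerSpace.dt (hu : ZPerSpace u) : ZPerSpace (dt u) := by
  intro t x k
  have h : u (fun i => x i + (k i : ℝ)) = u x := funext fun s => hu s x k
  simp only [_root_.dt, h]

theorem SmoothQ.dx_lapQ (hu : SmoothQ u) (i : Fin d) (x : Fin d → ℝ) (t : ℝ) :
    _root_.dx i (_root_.lapQ u) x t = _root_.lapQ (_root_.dx i u) x t := by
  have h := pder_sum Finset.univ
    (fun k _ => ((hu.dx k).dx k).space_differentiable t) i x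
  refine h.trans (Finset.sum_congr rfl fun k _ => ?_)
  have hs := hu.space t
  change pder i (pder k (pder k fun y => u y t)) x = pder k (pder k (pder i fun y => u y t)) x
  rw [pder_comm (hs.pder k) i k, pder_comm hs i k]

end PartialDerivatives

section CubeIntegrals

variable {d : ℕ}

theorem isCompact_unitCube : IsCompact (unitCube d) := isCompact_Icc

theorem Continuous.integrableOn_unitCube {G : Type*} [NormedAddCommGroup G]
    {g : (Fin d → ℝ) → G} (hg : Continuous g) : IntegrableOn g (unitCube d) :=
  hg.continuousOn.integrableOn_compact isCompact_unitCube

/-- A directional derivative of a periodic function has mean zero over the fundamental domain. -/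
theorem integral_fderiv_single_eq_zero {G : Type*} [NormedAddCommGroup G] [NormedSpace ℝ G]
    {g : (Fin d → ℝ) → G} (hg : ContDiff ℝ 1 g)
    (hper : ∀ (x : Fin d → ℝ) (k : Fin d → ℤ), g (fun i => x i + (k i : ℝ)) = g x) (i : Fin d) :
    ∫ x in unitCube d, fderiv ℝ g x (Pi.single i 1) = 0 := by
  rcases d with _ | n
  · exact i.elim0
  have hd := hg.differentiable (by simp)
  have hc : Continuous fun x => fderiv ℝ g x (Pi.single i 1) :=
    (hg.continuous_fderiv (by simp)).clm_apply continuous_const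
  have hsum : ∀ x, ∑ j, (if j = i then fderiv ℝ g x else 0) (Pi.single j 1)
      = fderiv ℝ g x (Pi.single i 1) := by
    intro x
    rw [Finset.sum_eq_single i (by intro j _ hj; simp [hj]) (by simp)]
    simp
  have h := integral_divergence_of_hasFDerivAt_off_countable' (E := G) (0 : Fin (n + 1) → ℝ) 1
    zero_le_one (fun j => if j = i then g else 0)
    (fun j x => if j = i then fderiv ℝ g x else 0) ∅ Set.countable_empty
    (fun j => by
      split_ifs
      · exact hd.continuous.continuousOn
      · exact continuousOn_const)
    (fun x _ j => by
      split_ifs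
      · exact (hd x).hasFDerivAt
      · exact hasFDerivAt_const 0 x)
    (by simp only [hsum]; exact hc.integrableOn_unitCube)
  simp only [hsum] at h
  refine h.trans (Finset.sum_eq_zero fun j _ => sub_eq_zero.2 ?_)
  by_cases hj : j = i
  · subst hj
    congr 1
    funext y
    simp only [if_true, Pi.one_apply, Pi.zero_apply]
    rw [← hper (j.insertNth 0 y) (Pi.single j 1)]
    congr 1
    funext k
    refine j.succAboveCases ?_ (fun l => ?_) k <;> simp
  · simp [hj]

theorem integral_pder_eq_zero {v : (Fin d → ℝ) → ℝ} (hv : ContDiff ℝ ∞ v) (hper : ZPer v)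
    (i : Fin d) : ∫ x in unitCube d, pder i v x = 0 := by
  simp only [pder_eq_fderiv (hv.differentiable (by simp))]
  exact integral_fderiv_single_eq_zero (hv.of_le (by simp)) hper i

theorem ZPer.mul {v w : (Fin d → ℝ) → ℝ} (hv : ZPer v) (hw : ZPer w) :
    ZPer fun x => v x * w x := fun x k => by simp only [hv x k, hw x k]

/-- Integration by parts on the torus. -/
theorem integral_mul_pder {v w : (Fin d → ℝ) → ℝ} (hv : ContDiff ℝ ∞ v) (hvp : ZPer v)
    (hw : ContDiff ℝ ∞ w) (hwp : ZPer w) (i : Fin d) :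
    ∫ x in unitCube d, v x * pder i w x = -∫ x in unitCube d, pder i v x * w x := by
  have h := integral_pder_eq_zero (hv.mul hw) (hvp.mul hwp) i
  simp only [pder_mul (hv.differentiable (by simp)) (hw.differentiable (by simp))] at h
  rw [integral_add ((hv.pder i).continuous.fun_mul hw.continuous).integrableOn_unitCube
    (hv.continuous.fun_mul (hw.pder i).continuous).integrableOn_unitCube] at h
  linarith

theorem contDiff_lap {v : (Fin d → ℝ) → ℝ} (hv : ContDiff ℝ ∞ v) : ContDiff ℝ ∞ (lap v) :=
  ContDiff.sum fun i _ => (hv.pder i).pder i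

theorem sum_integral_sq_pder {v : (Fin d → ℝ) → ℝ} (hv : ContDiff ℝ ∞ v) (hvp : ZPer v) :
    ∑ i, ∫ x in unitCube d, pder i v x ^ 2 = -∫ x in unitCube d, v x * lap v x := by
  simp only [lap, Finset.mul_sum]
  rw [integral_finsetSum _ fun i _ =>
    (hv.continuous.fun_mul ((hv.pder i).pder i).continuous).integrableOn_unitCube,
    ← Finset.sum_neg_distrib]
  refine Finset.sum_congr rfl fun i _ => ?_
  rw [integral_mul_pder hv hvp (hv.pder i) (hvp.pder i), neg_neg]
  simp only [sq]

theorem sum_integral_sq_pder_pder {v : (Fin d → ℝ) → ℝ} (hv : ContDiff ℝ ∞ v) (hvp : ZPer v) :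
    ∑ i, ∑ k, ∫ x in unitCube d, pder i (pder k v) x ^ 2
      = ∫ x in unitCube d, lap v x ^ 2 := by
  have key : ∀ i k, ∫ x in unitCube d, pder i (pder k v) x ^ 2
      = ∫ x in unitCube d, pder i (pder i v) x * pder k (pder k v) x := by
    intro i k
    have h1 := integral_mul_pder ((hv.pder i).pder k) ((hvp.pder i).pder k)
      (hv.pder i) (hvp.pder i) k
    have h2 := integral_mul_pder ((hv.pder k).pder k) ((hvp.pder k).pder k)
      (hv.pder i) (hvp.pder i) i
    have hc : pder k (pder k (pder i v)) = pder i (pder k (pder k v)) := by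
      rw [pder_comm hv k i, pder_comm (hv.pder k) k i]
    rw [hc] at h1
    simp only [pder_comm hv i k, sq]
    rw [h1, ← h2]
    simp only [mul_comm]
  simp only [key]
  simp only [lap, sq, Finset.sum_mul_sum]
  rw [integral_finsetSum]
  · refine Finset.sum_congr rfl fun i _ => ?_
    rw [integral_finsetSum]
    exact fun k _ =>
      (((hv.pder i).pder i).continuous.fun_mul ((hv.pder k).pder k).continuous).integrableOn_unitCube
  · exact fun i _ => (continuous_finsetSum _ fun k _ =>
      ((hv.pder i).pder i).continuous.fun_mul ((hv.pder k).pder k).continuous).integrableOn_unitCube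

theorem integral_sq_pder_le {v : (Fin d → ℝ) → ℝ} (hv : ContDiff ℝ ∞ v) (hvp : ZPer v)
    (i : Fin d) : ∫ x in unitCube d, pder i v x ^ 2
      ≤ (∫ x in unitCube d, v x ^ 2) + ∫ x in unitCube d, lap v x ^ 2 := by
  have h1 : ∫ x in unitCube d, pder i v x ^ 2 ≤ ∑ i, ∫ x in unitCube d, pder i v x ^ 2 :=
    Finset.single_le_sum (f := fun i => ∫ x in unitCube d, pder i v x ^ 2)
      (fun k _ => integral_nonneg fun x => sq_nonneg _) (Finset.mem_univ i)
  refine h1.trans ?_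
  have hl := (contDiff_lap hv).continuous
  rw [sum_integral_sq_pder hv hvp, ← integral_neg,
    ← integral_add (hv.continuous.fun_pow 2).integrableOn_unitCube (hl.fun_pow 2).integrableOn_unitCube]
  refine integral_mono (hv.continuous.fun_mul hl).fun_neg.integrableOn_unitCube
    ((hv.continuous.fun_pow 2).fun_add (hl.fun_pow 2)).integrableOn_unitCube fun x => ?_
  nlinarith [sq_nonneg (v x + lap v x), sq_nonneg (v x), sq_nonneg (lap v x)]

theorem integral_sq_pder_pder_le {v : (Fin d → ℝ) → ℝ} (hv : ContDiff ℝ ∞ v) (hvp : ZPer v)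
    (i k : Fin d) :
    ∫ x in unitCube d, pder i (pder k v) x ^ 2 ≤ ∫ x in unitCube d, lap v x ^ 2 := by
  rw [← sum_integral_sq_pder_pder hv hvp]
  have h0 : ∀ i k, 0 ≤ ∫ x in unitCube d, pder i (pder k v) x ^ 2 :=
    fun i k => integral_nonneg fun x => sq_nonneg _
  exact (Finset.single_le_sum (f := fun k => ∫ x in unitCube d, pder i (pder k v) x ^ 2)
      (fun k _ => h0 i k) (Finset.mem_univ k)).trans
    (Finset.single_le_sum (f := fun i => ∑ k, ∫ x in unitCube d, pder i (pder k v) x ^ 2)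
      (fun i _ => Finset.sum_nonneg fun k _ => h0 i k) (Finset.mem_univ i))

/-- A multi-index derivative is a composition of as many partial derivatives as its order. -/
theorem exists_mder_eq_foldr (j : Fin d → ℕ) (v : (Fin d → ℝ) → ℝ) :
    ∃ l : List (Fin d), l.length = ∑ i, j i ∧ (∀ i ∈ l, j i ≠ 0) ∧ mder j v = l.foldr pder v := by
  have hiter : ∀ (i : Fin d) (n : ℕ) (w : (Fin d → ℝ) → ℝ),
      (pder i)^[n] w = (List.replicate n i).foldr pder w := by
    intro i n w
    induction n with
    | zero => rfl
    | succ n ih => rw [Function.iterate_succ_apply', ih, List.replicate_succ, List.foldr_cons]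
  have key : ∀ L : List (Fin d), ∃ l : List (Fin d), l.length = (L.map j).sum ∧
      (∀ i ∈ l, j i ≠ 0) ∧ L.foldr (fun i acc => (pder i)^[j i] acc) v = l.foldr pder v := by
    intro L
    induction L with
    | nil => exact ⟨[], rfl, by simp, rfl⟩
    | cons i L ih =>
      obtain ⟨l, hl, hmem, h⟩ := ih
      refine ⟨List.replicate (j i) i ++ l, by simp [hl], fun k hk => ?_, ?_⟩
      · rcases List.mem_append.1 hk with hk | hk
        · rw [List.mem_replicate] at hk
          rw [hk.2]
          exact hk.1
        · exact hmem k hk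
      rw [List.foldr_cons, h, hiter, List.foldr_append]
  obtain ⟨l, hl, hmem, h⟩ := key (List.finRange d)
  exact ⟨l, by rw [hl, ← List.ofFn_eq_map, List.sum_ofFn], hmem, h⟩

theorem integral_sq_mder_le {v : (Fin d → ℝ) → ℝ} (hv : ContDiff ℝ ∞ v) (hvp : ZPer v)
    (j : Fin d → ℕ) (hj : ∑ i, j i ≤ 2) : ∫ x in unitCube d, mder j v x ^ 2
      ≤ (∫ x in unitCube d, v x ^ 2) + ∫ x in unitCube d, lap v x ^ 2 := by
  have h1 : 0 ≤ ∫ x in unitCube d, v x ^ 2 := integral_nonneg fun x => sq_nonneg _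
  have h2 : 0 ≤ ∫ x in unitCube d, lap v x ^ 2 := integral_nonneg fun x => sq_nonneg _
  obtain ⟨l, hl, -, h⟩ := exists_mder_eq_foldr j v
  rw [h]
  rw [← hl] at hj
  match l, hj with
  | [], _ => simpa using h2
  | [i], _ => exact integral_sq_pder_le hv hvp i
  | [i, k], _ => exact (integral_sq_pder_pder_le hv hvp i k).trans (by linarith)
  | _ :: _ :: _ :: _, hj => simp at hj

end CubeIntegrals

noncomputable section EnergyEstimate

variable {d : ℕ} {T : ℝ}

/-- Lebesgue measure on the space-time cylinder `[0,1]^d × (0,T]`. -/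
def muQ (d : ℕ) (T : ℝ) : Measure ((Fin d → ℝ) × ℝ) :=
  (volume.restrict (unitCube d)).prod (volume.restrict (Set.Ioc 0 T))

theorem muQ_eq_restrict :
    muQ d T = (volume.prod volume).restrict (unitCube d ×ˢ Set.Ioc (0 : ℝ) T) :=
  Measure.prod_restrict _ _

theorem measurableSet_unitCube : MeasurableSet (unitCube d) := measurableSet_Icc

theorem Continuous.integrable_muQ {G : (Fin d → ℝ) × ℝ → ℝ} (hG : Continuous G) :
    Integrable G (muQ d T) := by
  rw [muQ_eq_restrict]
  have hK : IsCompact (unitCube d ×ˢ Set.Icc (0 : ℝ) T) := isCompact_unitCube.prod isCompact_Icc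
  exact (hG.continuousOn.integrableOn_compact (μ := volume) hK).mono_set
    (Set.prod_mono_right Set.Ioc_subset_Icc_self)

theorem integral_muQ_eq {G : (Fin d → ℝ) × ℝ → ℝ} (hG : Continuous G) :
    ∫ p, G p ∂muQ d T = ∫ x in unitCube d, ∫ t in Set.Ioc 0 T, G (x, t) :=
  integral_prod _ hG.integrable_muQ

theorem integral_muQ_eq_symm {G : (Fin d → ℝ) × ℝ → ℝ} (hG : Continuous G) :
    ∫ p, G p ∂muQ d T = ∫ t in Set.Ioc 0 T, ∫ x in unitCube d, G (x, t) :=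
  integral_prod_symm _ hG.integrable_muQ

/-- Monotonicity of the space-time integral, tested on `[0,1]^d × (0,T]` only. -/
theorem integral_muQ_mono {G H : (Fin d → ℝ) × ℝ → ℝ} (hG : Continuous G) (hH : Continuous H)
    (h : ∀ x, ∀ t ∈ Set.Ioc 0 T, G (x, t) ≤ H (x, t)) :
    ∫ p, G p ∂muQ d T ≤ ∫ p, H p ∂muQ d T := by
  refine integral_mono_ae hG.integrable_muQ hH.integrable_muQ ?_
  rw [muQ_eq_restrict]
  filter_upwards [ae_restrict_mem (measurableSet_unitCube.prod measurableSet_Ioc)] with p hp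
  exact h p.1 p.2 hp.2

theorem integral_mul_dt_nonneg (hT : 0 ≤ T) {q : (Fin d → ℝ) → ℝ → ℝ} (hq : SmoothQ q)
    (h0 : ∀ x, q x 0 = 0) : 0 ≤ ∫ p, q p.1 p.2 * dt q p.1 p.2 ∂muQ d T := by
  rw [integral_muQ_eq (hq.continuous.fun_mul hq.dt.continuous)]
  refine integral_nonneg fun x => ?_
  have hd : ∀ t ∈ Set.uIcc 0 T, HasDerivAt (fun s => q x s ^ 2 / 2) (q x t * dt q x t) t := by
    intro t _
    have h := ((hq.hasDerivAt_dt x t).pow 2).div_const 2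
    have e : q x t * dt q x t = (2 : ℕ) * q x t ^ (2 - 1) * dt q x t / 2 := by
      norm_num
      ring
    rw [e]
    exact h
  have hc : Continuous fun t => q x t * dt q x t :=
    (hq.time x).continuous.fun_mul (hq.dt.time x).continuous
  have := intervalIntegral.integral_eq_sub_of_hasDerivAt hd (hc.intervalIntegrable 0 T)
  rw [intervalIntegral.integral_of_le hT, h0 x] at this
  simp only [Pi.zero_apply, this]
  have := sq_nonneg (q x T)
  linarith

theorem integral_mul_dx {v w : (Fin d → ℝ) → ℝ → ℝ} (hv : SmoothQ v) (hvp : ZPerSpace v)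
    (hw : SmoothQ w) (hwp : ZPerSpace w) (i : Fin d) :
    ∫ p, v p.1 p.2 * dx i w p.1 p.2 ∂muQ d T = -∫ p, dx i v p.1 p.2 * w p.1 p.2 ∂muQ d T := by
  rw [integral_muQ_eq_symm (hv.continuous.fun_mul (hw.dx i).continuous),
    integral_muQ_eq_symm ((hv.dx i).continuous.fun_mul hw.continuous), ← integral_neg]
  exact integral_congr_ae (.of_forall fun t =>
    integral_mul_pder (hv.space t) (hvp t) (hw.space t) (hwp t) i)

theorem integral_mul_lapQ {v w : (Fin d → ℝ) → ℝ → ℝ} (hv : SmoothQ v) (hvp : ZPerSpace v)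
    (hw : SmoothQ w) (hwp : ZPerSpace w) :
    ∫ p, v p.1 p.2 * lapQ w p.1 p.2 ∂muQ d T
      = -∑ i, ∫ p, dx i v p.1 p.2 * dx i w p.1 p.2 ∂muQ d T := by
  simp only [lapQ, Finset.mul_sum]
  rw [integral_finsetSum _ fun i _ =>
    (hv.continuous.fun_mul ((hw.dx i).dx i).continuous).integrable_muQ, ← Finset.sum_neg_distrib]
  exact Finset.sum_congr rfl fun i _ => integral_mul_dx hv hvp (hw.dx i) (hwp.dx i) i

theorem dx_initial_eq_zero {v : (Fin d → ℝ) → ℝ → ℝ} (h0 : ∀ x, v x 0 = 0) (i : Fin d)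
    (x : Fin d → ℝ) : dx i v x 0 = 0 := by
  simp [dx, pder, h0]

theorem integral_dt_mul_lapQ_nonpos (hT : 0 ≤ T) {v : (Fin d → ℝ) → ℝ → ℝ} (hv : SmoothQ v)
    (hvp : ZPerSpace v) (h0 : ∀ x, v x 0 = 0) :
    ∫ p, dt v p.1 p.2 * lapQ v p.1 p.2 ∂muQ d T ≤ 0 := by
  rw [integral_mul_lapQ hv.dt hvp.dt hv hvp, neg_nonpos]
  refine Finset.sum_nonneg fun i _ => ?_
  simp only [← hv.dt_dx i, mul_comm (dt _ _ _)]
  exact integral_mul_dt_nonneg hT (hv.dx i) (dx_initial_eq_zero h0 i)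

/-- Energy estimates for the inhomogeneous heat equation with zero initial value. -/
theorem energy_estimates {θ m K : ℝ} (hT : 0 ≤ T) (hθ : 0 < θ) (hm : 0 < m)
    {f : (Fin d → ℝ) → ℝ} (hfm : ∀ x, m ≤ f x) (hfK : ∀ x, f x ≤ K)
    {g v : (Fin d → ℝ) → ℝ → ℝ} (hg : Continuous fun p : (Fin d → ℝ) × ℝ => g p.1 p.2)
    (hv : InhomSol T θ f g v) :
    m ^ 2 * ∫ p, v p.1 p.2 ^ 2 ∂muQ d T ≤ ∫ p, g p.1 p.2 ^ 2 ∂muQ d T ∧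
    (∫ p, dt v p.1 p.2 ^ 2 ∂muQ d T) + θ ^ 2 / 4 * ∫ p, lapQ v p.1 p.2 ^ 2 ∂muQ d T
      ≤ 2 * (∫ p, g p.1 p.2 ^ 2 ∂muQ d T) + 2 * K ^ 2 * ∫ p, v p.1 p.2 ^ 2 ∂muQ d T := by
  obtain ⟨hs, hp, hpde, h0⟩ := hv
  have hpde' : ∀ x, ∀ t ∈ Set.Ioc 0 T, dt v x t = θ / 2 * lapQ v x t - f x * v x t + g x t := hpde
  have cv := hs.continuous
  have ct := hs.dt.continuous
  have cl := hs.lapQ.continuous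
  have cvt := cv.fun_mul ct
  have cvl := cv.fun_mul cl
  have ctl := ct.fun_mul cl
  have A1 := integral_mul_dt_nonneg hT hs h0
  have A2 : ∫ p, v p.1 p.2 * lapQ v p.1 p.2 ∂muQ d T ≤ 0 := by
    rw [integral_mul_lapQ hs hp hs hp, neg_nonpos]
    exact Finset.sum_nonneg fun i _ => integral_nonneg fun p => mul_self_nonneg _
  have A3 := integral_dt_mul_lapQ_nonpos hT hs hp h0
  constructor
  · have key : ∫ p, (m ^ 2 * v p.1 p.2 ^ 2 + 2 * m * (v p.1 p.2 * dt v p.1 p.2)) ∂muQ d T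
        ≤ ∫ p, (m * θ * (v p.1 p.2 * lapQ v p.1 p.2) + g p.1 p.2 ^ 2) ∂muQ d T := by
      refine integral_muQ_mono (by fun_prop) (by fun_prop) fun x t ht => ?_
      simp only
      rw [hpde' x t ht]
      have := mul_nonneg (mul_nonneg hm.le (sub_nonneg.2 (hfm x))) (sq_nonneg (v x t))
      nlinarith [sq_nonneg (m * v x t - g x t)]
    rw [integral_add ((cv.fun_pow 2).integrable_muQ.const_mul _) (cvt.integrable_muQ.const_mul _),
      integral_add (cvl.integrable_muQ.const_mul _) (hg.fun_pow 2).integrable_muQ,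
      integral_const_mul, integral_const_mul, integral_const_mul] at key
    nlinarith [mul_nonneg hm.le A1, mul_nonneg (mul_pos hm hθ).le (neg_nonneg.2 A2)]
  · have key : ∫ p, (dt v p.1 p.2 ^ 2 + θ ^ 2 / 4 * lapQ v p.1 p.2 ^ 2) ∂muQ d T
        ≤ ∫ p, (2 * g p.1 p.2 ^ 2 + 2 * K ^ 2 * v p.1 p.2 ^ 2
          + θ * (dt v p.1 p.2 * lapQ v p.1 p.2)) ∂muQ d T := by
      refine integral_muQ_mono (by fun_prop) (by fun_prop) fun x t ht => ?_
      simp only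
      have h1 := hpde' x t ht
      have h2 : (dt v x t - θ / 2 * lapQ v x t) ^ 2 = (g x t - f x * v x t) ^ 2 := by
        rw [h1]; ring
      have h3 : f x ^ 2 * v x t ^ 2 ≤ K ^ 2 * v x t ^ 2 := by
        have := hm.le.trans (hfm x)
        gcongr
        exact hfK x
      nlinarith [sq_nonneg (g x t + f x * v x t)]
    rw [integral_add (ct.fun_pow 2).integrable_muQ ((cl.fun_pow 2).integrable_muQ.const_mul _),
      integral_add (((hg.fun_pow 2).integrable_muQ.const_mul _).fun_add
        ((cv.fun_pow 2).integrable_muQ.const_mul _)) (ctl.integrable_muQ.const_mul _),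
      integral_add ((hg.fun_pow 2).integrable_muQ.const_mul _)
        ((cv.fun_pow 2).integrable_muQ.const_mul _),
      integral_const_mul, integral_const_mul, integral_const_mul, integral_const_mul] at key
    nlinarith [mul_nonneg hθ.le (neg_nonneg.2 A3)]

/-- The parabolic Sobolev norm is controlled by `v`, `∂ₜ v` and `Δₓ v`. -/
theorem exists_h21Sq_le (d : ℕ) : ∃ N : ℝ, 0 ≤ N ∧ ∀ (T : ℝ) (v : (Fin d → ℝ) → ℝ → ℝ),
    SmoothQ v → ZPerSpace v →
    h21Sq T v ≤ (N + 1) * (∫ p, v p.1 p.2 ^ 2 ∂muQ d T) + N * (∫ p, lapQ v p.1 p.2 ^ 2 ∂muQ d T)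
      + ∫ p, dt v p.1 p.2 ^ 2 ∂muQ d T := by
  classical
  set S := Finset.univ.filter (fun j : Fin d → Fin 3 => (∑ i, (j i : ℕ)) ≤ 2) with hS
  refine ⟨S.card, by positivity, fun T v hs hp => ?_⟩
  have cv := hs.continuous.fun_pow 2
  have cl := hs.lapQ.continuous.fun_pow 2
  have ct := hs.dt.continuous.fun_pow 2
  have hsl : ∀ t, ∑ j ∈ S, ∫ x in unitCube d, mder (fun i => (j i : ℕ)) (fun y => v y t) x ^ 2
      ≤ S.card * ((∫ x in unitCube d, v x t ^ 2) + ∫ x in unitCube d, lapQ v x t ^ 2) := by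
    intro t
    rw [← nsmul_eq_mul]
    exact Finset.sum_le_card_nsmul _ _ _ fun j hj =>
      integral_sq_mder_le (hs.space t) (hp t) _ (Finset.mem_filter.1 hj).2
  have iv : Integrable (fun t => ∫ x in unitCube d, v x t ^ 2) (volume.restrict (Set.Ioc 0 T)) :=
    cv.integrable_muQ.integral_prod_right
  have il : Integrable (fun t => ∫ x in unitCube d, lapQ v x t ^ 2)
      (volume.restrict (Set.Ioc 0 T)) := cl.integrable_muQ.integral_prod_right
  have h1 : ∫ t in Set.Ioc (0 : ℝ) T, ∑ j ∈ S, ∫ x in unitCube d,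
      mder (fun i => (j i : ℕ)) (fun y => v y t) x ^ 2
      ≤ S.card * ((∫ p, v p.1 p.2 ^ 2 ∂muQ d T) + ∫ p, lapQ v p.1 p.2 ^ 2 ∂muQ d T) := by
    rw [integral_muQ_eq_symm cv, integral_muQ_eq_symm cl, ← integral_add iv il,
      ← integral_const_mul]
    exact integral_mono_of_nonneg
      (.of_forall fun t => Finset.sum_nonneg fun j _ => integral_nonneg fun x => sq_nonneg _)
      ((iv.fun_add il).const_mul _) (.of_forall hsl)
  have h2 : ∫ x in unitCube d, ∫ t in Set.Ioc (0 : ℝ) T, ((v x t) ^ 2 + (deriv (v x) t) ^ 2)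
      = (∫ p, v p.1 p.2 ^ 2 ∂muQ d T) + ∫ p, dt v p.1 p.2 ^ 2 ∂muQ d T := by
    rw [← integral_add cv.integrable_muQ ct.integrable_muQ, integral_muQ_eq (cv.fun_add ct)]
    rfl
  rw [h21Sq, h2]
  linarith

end EnergyEstimate

noncomputable section MaximumPrinciple

variable {d : ℕ} {T : ℝ}

theorem ZPer.exists_mem_unitCube {v : (Fin d → ℝ) → ℝ} (hv : ZPer v) (x : Fin d → ℝ) :
    (fun i => Int.fract (x i)) ∈ unitCube d ∧ v (fun i => Int.fract (x i)) = v x := by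
  refine ⟨⟨fun i => Int.fract_nonneg _, fun i => (Int.fract_lt_one _).le⟩, ?_⟩
  rw [← hv x fun i => -⌊x i⌋]
  congr 1
  funext i
  rw [Int.fract]
  push_cast
  ring

theorem ZPer.exists_bound {v : (Fin d → ℝ) → ℝ} (hv : ZPer v) (hc : Continuous v) :
    ∃ C, 0 ≤ C ∧ ∀ x, |v x| ≤ C := by
  obtain ⟨C, hC⟩ := isCompact_unitCube.exists_bound_of_continuousOn hc.continuousOn
  refine ⟨|C|, abs_nonneg C, fun x => ?_⟩
  obtain ⟨hm, hx⟩ := hv.exists_mem_unitCube x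
  rw [← hx]
  exact (hC _ hm).trans (le_abs_self C)

theorem deriv_deriv_nonpos_of_isMax {φ : ℝ → ℝ} {a : ℝ} (hφ : Differentiable ℝ φ)
    (h : ∀ s, φ s ≤ φ a) : deriv (deriv φ) a ≤ 0 := by
  by_contra! hpos
  have hmax : IsLocalMax φ a := .of_forall h
  have hmin := isLocalMin_of_deriv_deriv_pos hpos hmax.deriv_eq_zero (hφ a).continuousAt
  have hconst : φ =ᶠ[nhds a] fun _ => φ a := by
    filter_upwards [hmin] with s hs using le_antisymm (h s) hs
  have h1 : deriv φ =ᶠ[nhds a] fun _ => 0 := by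
    simpa using hconst.deriv
  rw [h1.deriv_eq] at hpos
  simp at hpos

theorem lap_nonpos_of_isMax {v : (Fin d → ℝ) → ℝ} (hv : ContDiff ℝ ∞ v) {x : Fin d → ℝ}
    (h : ∀ y, v y ≤ v x) : lap v x ≤ 0 := by
  refine Finset.sum_nonpos fun i _ => ?_
  have hφ : Differentiable ℝ fun s => v (Function.update x i s) := fun s =>
    ((hv.differentiable (by simp)) _).comp s (hasDerivAt_update x i s).differentiableAt
  have h1 : (fun s => pder i v (Function.update x i s))
      = deriv fun s => v (Function.update x i s) := by
    funext s
    simp [pder]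
  rw [pder, h1]
  exact deriv_deriv_nonpos_of_isMax hφ fun s => by simpa using h _

theorem deriv_nonneg_of_isMaxOn_left {φ : ℝ → ℝ} {a b : ℝ} (hab : a < b)
    (hφ : DifferentiableAt ℝ φ b) (h : ∀ s ∈ Set.Icc a b, φ s ≤ φ b) : 0 ≤ deriv φ b := by
  have hd := hφ.hasDerivAt.hasDerivWithinAt (s := Set.Iio b)
  rw [hasDerivWithinAt_iff_tendsto_slope' (by simp)] at hd
  refine ge_of_tendsto hd ?_
  filter_upwards [Ioo_mem_nhdsLT hab] with s hs
  rw [slope_def_field]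
  exact div_nonneg_of_nonpos (by linarith [h s ⟨hs.1.le, hs.2.le⟩]) (by linarith [hs.2])

/-- One-sided parabolic maximum principle on the torus. -/
theorem le_of_subsolution (hT : 0 ≤ T) {θ A M : ℝ} (hθ : 0 ≤ θ) (hA : 0 ≤ A) (hM : 0 ≤ M)
    {v : (Fin d → ℝ) → ℝ → ℝ} (hs : SmoothQ v) (hp : ZPerSpace v)
    (hpde : ∀ x, ∀ t ∈ Set.Ioc 0 T, 0 < v x t → dt v x t ≤ θ / 2 * lapQ v x t + M)
    (h0 : ∀ x, v x 0 ≤ A) (x : Fin d → ℝ) {t : ℝ} (ht : t ∈ Set.Icc 0 T) :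
    v x t ≤ A + M * t := by
  suffices h : ∀ ε > 0, v x t ≤ A + (M + ε) * t by
    refine le_of_forall_pos_le_add fun δ hδ => ?_
    have hT1 : 0 < T + 1 := by linarith
    refine (h (δ / (T + 1)) (by positivity)).trans ?_
    have : δ / (T + 1) * t ≤ δ := by
      rw [div_mul_eq_mul_div, div_le_iff₀ hT1]
      nlinarith [ht.2]
    linarith
  intro ε hε
  set z : (Fin d → ℝ) × ℝ → ℝ := fun p => v p.1 p.2 - (A + (M + ε) * p.2) with hz
  have hzc : ContinuousOn z (unitCube d ×ˢ Set.Icc 0 T) :=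
    (hs.continuous.sub (by fun_prop)).continuousOn
  obtain ⟨⟨y, s⟩, ⟨-, hsT⟩, hmax⟩ := (isCompact_unitCube.prod isCompact_Icc).exists_isMaxOn
    ⟨(0, 0), ⟨⟨le_refl _, zero_le_one⟩, ⟨le_refl _, hT⟩⟩⟩ hzc
  have hmax' : ∀ y', ∀ s' ∈ Set.Icc 0 T, z (y', s') ≤ z (y, s) := by
    intro y' s' hs'
    obtain ⟨hm, he⟩ := (hp s').exists_mem_unitCube y'
    have : z (y', s') = z (fun i => Int.fract (y' i), s') := by simp only [hz]; rw [he]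
    rw [this]
    exact hmax ⟨hm, hs'⟩
  suffices hneg : z (y, s) ≤ 0 by
    have := (hmax' x t ht).trans hneg
    simp only [hz] at this
    linarith
  by_contra! hpos
  simp only [hz] at hpos
  have hMs : 0 ≤ (M + ε) * s := mul_nonneg (by linarith) hsT.1
  have hs0 : 0 < s := by
    refine lt_of_le_of_ne hsT.1 fun h => ?_
    rw [← h] at hpos
    linarith [h0 y]
  have hlap : lapQ v y s ≤ 0 := by
    refine lap_nonpos_of_isMax (hs.space s) fun y' => ?_
    have := hmax' y' s hsT
    simp only [hz] at this
    linarith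
  have htime : 0 ≤ dt v y s - (M + ε) := by
    have hd : HasDerivAt (fun r => z (y, r)) (dt v y s - (M + ε)) s := by
      have := (hs.hasDerivAt_dt y s).sub
        (((hasDerivAt_id s).const_mul (M + ε)).const_add A)
      rw [mul_one] at this
      exact this
    rw [← hd.deriv]
    exact deriv_nonneg_of_isMaxOn_left hs0 hd.differentiableAt
      fun r hr => hmax' y r ⟨hr.1, hr.2.trans hsT.2⟩
  have := hpde y s ⟨hs0, hsT.2⟩ (by linarith)
  have := mul_nonneg hθ (neg_nonneg.2 hlap)
  linarith

theorem lapQ_neg (v : (Fin d → ℝ) → ℝ → ℝ) (x : Fin d → ℝ) (t : ℝ) :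
    lapQ (fun y s => -v y s) x t = -lapQ v x t := by
  have h : ∀ i, dx i (fun y s => -v y s) = fun y s => -dx i v y s := fun i => by
    funext y s
    exact pder_neg (fun z => v z s) i y
  simp only [lapQ, h]
  rw [← Finset.sum_neg_distrib]
  refine Finset.sum_congr rfl fun i _ => ?_
  exact pder_neg (fun z => dx i v z t) i x

/-- Sup-norm bound for the inhomogeneous heat equation with nonnegative absorption. -/
theorem abs_le_of_solution (hT : 0 ≤ T) {θ A M : ℝ} (hθ : 0 ≤ θ) (hA : 0 ≤ A) (hM : 0 ≤ M)
    {f : (Fin d → ℝ) → ℝ} (hf : ∀ x, 0 ≤ f x) {g v : (Fin d → ℝ) → ℝ → ℝ}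
    (hs : SmoothQ v) (hp : ZPerSpace v)
    (hpde : ∀ x, ∀ t ∈ Set.Ioc 0 T, dt v x t = θ / 2 * lapQ v x t - f x * v x t + g x t)
    (hg : ∀ x, ∀ t ∈ Set.Ioc 0 T, |g x t| ≤ M) (h0 : ∀ x, |v x 0| ≤ A)
    (x : Fin d → ℝ) {t : ℝ} (ht : t ∈ Set.Icc 0 T) : |v x t| ≤ A + M * T := by
  have hMt : A + M * t ≤ A + M * T := by nlinarith [ht.2]
  rw [abs_le']
  constructor
  · refine (le_of_subsolution hT hθ hA hM hs hp (fun y s hsT hpos => ?_)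
      (fun y => (le_abs_self _).trans (h0 y)) x ht).trans hMt
    rw [hpde y s hsT]
    linarith [mul_nonneg (hf y) hpos.le, le_abs_self (g y s), hg y s hsT]
  · refine (le_of_subsolution (v := fun y s => -v y s) hT hθ hA hM hs.neg
      (fun s y k => by simp only [hp s y k]) (fun y s hsT hpos => ?_)
      (fun y => (neg_le_abs _).trans (h0 y)) x ht).trans hMt
    have hd : dt (fun y s => -v y s) y s = -dt v y s := (hs.hasDerivAt_dt y s).neg.deriv
    rw [hd, hpde y s hsT, lapQ_neg]
    linarith [mul_nonneg (hf y) hpos.le, neg_le_abs (g y s), hg y s hsT]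

/-- A spatial derivative of a solution solves the differentiated equation. -/
theorem dt_dx_of_solution {θ : ℝ} {f : (Fin d → ℝ) → ℝ} (hf : ContDiff ℝ ∞ f)
    {g v : (Fin d → ℝ) → ℝ → ℝ} (hg : SmoothQ g) (hs : SmoothQ v) {t : ℝ}
    (hpde : ∀ x, dt v x t = θ / 2 * lapQ v x t - f x * v x t + g x t) (i : Fin d)
    (x : Fin d → ℝ) :
    dt (dx i v) x t = θ / 2 * lapQ (dx i v) x t - f x * dx i v x t
      + (dx i g x t - pder i f x * v x t) := by
  have dl := hs.lapQ.space_differentiable t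
  have dv := hs.space_differentiable t
  have df : Differentiable ℝ f := hf.differentiable (by simp)
  have h : dx i (dt v) x t
      = pder i (fun y => θ / 2 * lapQ v y t - f y * v y t + g y t) x :=
    congrArg (fun w => pder i w x) (funext hpde)
  rw [hs.dt_dx, h, pder_add ((dl.const_mul _).fun_sub (df.fun_mul dv)) (hg.space_differentiable t),
    pder_sub (dl.const_mul _) (df.fun_mul dv), pder_const_mul, pder_mul df dv]
  have := hs.dx_lapQ i x t
  simp only [dx] at this ⊢
  rw [this]
  ring

/-- Bounds for a solution of the heat equation and for its pure second derivatives, in terms of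
bounds on the coefficient and the initial value. -/
theorem exists_bound_heatSol (hT : 0 ≤ T) {u0 : (Fin d → ℝ) → ℝ} (hu0 : ContDiff ℝ ∞ u0)
    (hu0p : ZPer u0) {K : ℝ} (hK : 0 ≤ K) :
    ∃ B, 0 ≤ B ∧ ∀ θ, 0 ≤ θ → ∀ f : (Fin d → ℝ) → ℝ, ContDiff ℝ ∞ f → (∀ x, 0 ≤ f x) →
      (∀ i x, |pder i f x| ≤ K) → (∀ i x, |pder i (pder i f) x| ≤ K) →
      ∀ u, HeatSol T θ f u0 u → ∀ x, ∀ t ∈ Set.Icc 0 T,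
        |u x t| ≤ B ∧ ∀ i, |dx i (dx i u) x t| ≤ B := by
  obtain ⟨A0, hA0, hb0⟩ := hu0p.exists_bound hu0.continuous
  choose A1 hA1 hb1 using fun i => (hu0p.pder i).exists_bound (hu0.pder i).continuous
  choose A2 hA2 hb2 using fun i => ((hu0p.pder i).pder i).exists_bound
    ((hu0.pder i).pder i).continuous
  set B1 : Fin d → ℝ := fun i => A1 i + K * A0 * T
  have hB1 : ∀ i, 0 ≤ B1 i := fun i => add_nonneg (hA1 i) (by positivity)
  set B2 : Fin d → ℝ := fun i => A2 i + (2 * (K * B1 i) + K * A0) * T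
  have hM2 : ∀ i, 0 ≤ 2 * (K * B1 i) + K * A0 := fun i => by
    have := hB1 i
    positivity
  have hB2 : ∀ i, 0 ≤ B2 i := fun i => add_nonneg (hA2 i) (mul_nonneg (hM2 i) hT)
  have hsum : 0 ≤ ∑ i, B2 i := Finset.sum_nonneg fun i _ => hB2 i
  refine ⟨A0 + ∑ i, B2 i, by positivity, fun θ hθ f hf hf0 hf1 hf2 u hu => ?_⟩
  obtain ⟨hs, hp, hpde, hinit⟩ := hu
  have hfs := SmoothQ.of_space hf
  have e0 : ∀ x, ∀ t ∈ Set.Ioc 0 T, dt u x t = θ / 2 * lapQ u x t - f x * u x t + 0 :=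
    fun x t ht => (hpde x t ht).trans (add_zero _).symm
  have u0eq : (fun y => u y 0) = u0 := funext hinit
  have b0 : ∀ x, ∀ t ∈ Set.Icc 0 T, |u x t| ≤ A0 := by
    intro x t ht
    have := abs_le_of_solution (g := fun _ _ => 0) hT hθ hA0 le_rfl hf0 hs hp e0 (by simp)
      (fun y => by rw [hinit]; exact hb0 y) x ht
    simpa using this
  have hg1 : ∀ i, SmoothQ fun x t => -(pder i f x * u x t) := fun i =>
    ((SmoothQ.of_space (hf.pder i)).mul hs).neg
  have e1 : ∀ i x, ∀ t ∈ Set.Ioc 0 T, dt (dx i u) x t = θ / 2 * lapQ (dx i u) x t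
      - f x * dx i u x t + -(pder i f x * u x t) := by
    intro i x t ht
    have h := dt_dx_of_solution (g := fun _ _ => 0) hf contDiff_const hs (fun y => e0 y t ht) i x
    have hz : dx i (fun _ _ => (0 : ℝ)) x t = 0 := by simp [dx, pder]
    rw [h, hz, zero_sub]
  have b1 : ∀ i x, ∀ t ∈ Set.Icc 0 T, |dx i u x t| ≤ B1 i := by
    intro i x t ht
    refine abs_le_of_solution hT hθ (hA1 i) (by positivity) hf0 (hs.dx i) (hp.dx i) (e1 i)
      (fun y s hsT => ?_) (fun y => ?_) x ht
    · rw [abs_neg, abs_mul]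
      exact mul_le_mul (hf1 i y) (b0 y s ⟨hsT.1.le, hsT.2⟩) (abs_nonneg _) hK
    · simp only [dx, u0eq]
      exact hb1 i y
  have b2 : ∀ i x, ∀ t ∈ Set.Icc 0 T, |dx i (dx i u) x t| ≤ B2 i := by
    intro i x t ht
    refine abs_le_of_solution hT hθ (hA2 i) (hM2 i) hf0 ((hs.dx i).dx i)
      ((hp.dx i).dx i)
      (fun y s hsT => dt_dx_of_solution hf (hg1 i) (hs.dx i) (fun z => e1 i z s hsT) i y)
      (fun y s hsT => ?_) (fun y => ?_) x ht
    · have hmem : s ∈ Set.Icc 0 T := ⟨hsT.1.le, hsT.2⟩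
      have h : dx i (fun x t => -(pder i f x * u x t)) y s
          = -(pder i (pder i f) y * u y s + pder i f y * dx i u y s) := by
        simp only [dx]
        rw [pder_neg, pder_mul ((hf.pder i).differentiable (by simp))
          (hs.space_differentiable s)]
      have m1 : |pder i (pder i f) y * u y s| ≤ K * A0 := by
        rw [abs_mul]
        exact mul_le_mul (hf2 i y) (b0 y s hmem) (abs_nonneg _) hK
      have m2 : |pder i f y * dx i u y s| ≤ K * B1 i := by
        rw [abs_mul]
        exact mul_le_mul (hf1 i y) (b1 i y s hmem) (abs_nonneg _) hK
      rw [h, abs_le]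
      rw [abs_le] at m1 m2
      constructor <;> linarith [m1.1, m1.2, m2.1, m2.2]
    · simp only [dx, u0eq]
      exact hb2 i y
  intro x t ht
  refine ⟨(b0 x t ht).trans (by linarith), fun i => (b2 i x t ht).trans ?_⟩
  linarith [Finset.single_le_sum (fun k _ => hB2 k) (Finset.mem_univ i)]

end MaximumPrinciple

noncomputable section SobolevEmbedding

open UnitAddTorus

variable {d : ℕ}

/-- Phase of the `n`-th Fourier monomial on the torus. -/
def fourierPhase (n : Fin d → ℤ) : (Fin d → ℝ) →L[ℝ] ℂ :=
  ∑ j, (-(2 * π * Complex.I * n j)) • Complex.ofRealCLM.comp (ContinuousLinearMap.proj j)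

theorem fourierPhase_apply (n : Fin d → ℤ) (x : Fin d → ℝ) :
    fourierPhase n x = ∑ j, -(2 * π * Complex.I * n j) * x j := by
  simp [fourierPhase]

theorem fourierPhase_single (n : Fin d → ℤ) (i : Fin d) :
    fourierPhase n (Pi.single i 1) = -(2 * π * Complex.I * n i) := by
  rw [fourierPhase_apply, Finset.sum_eq_single i (by intro j _ hj; simp [hj]) (by simp)]
  simp

/-- The `n`-th Fourier coefficient of a periodic function on `ℝ^d`. -/
def cubeCoeff (F : (Fin d → ℝ) → ℝ) (n : Fin d → ℤ) : ℂ :=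
  ∫ x in unitCube d, Complex.exp (fourierPhase n x) * F x

theorem mFourier_neg_coe (n : Fin d → ℤ) (x : Fin d → ℝ) :
    mFourier (-n) (fun i => (x i : UnitAddCircle)) = Complex.exp (fourierPhase n x) := by
  rw [fourierPhase_apply, Complex.exp_sum]
  change ∏ j, fourier ((-n) j) (x j : UnitAddCircle) = _
  refine Finset.prod_congr rfl fun j _ => ?_
  rw [fourier_coe_apply]
  congr 1
  simp only [Pi.neg_apply]
  push_cast
  ring

theorem setIntegral_piIoc_eq {G : Type*} [NormedAddCommGroup G] [NormedSpace ℝ G]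
    (g : (Fin d → ℝ) → G) :
    ∫ x in {x : Fin d → ℝ | ∀ i, x i ∈ Set.Ioc ((0 : Fin d → ℝ) i) ((0 : Fin d → ℝ) i + 1)}, g x
      = ∫ x in unitCube d, g x := by
  refine setIntegral_congr_set ?_
  have hs : {x : Fin d → ℝ | ∀ i, x i ∈ Set.Ioc ((0 : Fin d → ℝ) i) ((0 : Fin d → ℝ) i + 1)}
      = Set.univ.pi fun i => Set.Ioc ((0 : Fin d → ℝ) i) ((1 : Fin d → ℝ) i) := by
    ext x
    simp
  rw [hs]
  exact Measure.univ_pi_Ioc_ae_eq_Icc (μ := fun _ : Fin d => (volume : Measure ℝ))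

theorem mFourierCoeff_eq_cubeCoeff {F : (Fin d → ℝ) → ℝ} {Ft : UnitAddTorus (Fin d) → ℂ}
    (h : ∀ x : Fin d → ℝ, Ft (fun i => (x i : UnitAddCircle)) = F x) (n : Fin d → ℤ) :
    mFourierCoeff Ft n = cubeCoeff F n := by
  rw [mFourierCoeff_eq_integral Ft n 0, setIntegral_piIoc_eq, cubeCoeff]
  simp only [h, mFourier_neg_coe, smul_eq_mul]

/-- A continuous periodic function descends to the torus. -/
theorem exists_lift_unitAddTorus {F : (Fin d → ℝ) → ℝ} (hF : Continuous F) (hp : ZPer F) :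
    ∃ Ft : C(UnitAddTorus (Fin d), ℂ),
      ∀ x : Fin d → ℝ, Ft (fun i => (x i : UnitAddCircle)) = F x := by
  set G : UnitAddTorus (Fin d) → ℂ :=
    fun y => F fun i => (AddCircle.equivIco 1 0 (y i) : ℝ) with hG
  have hval : ∀ x : Fin d → ℝ, G (fun i => (x i : UnitAddCircle)) = F x := by
    intro x
    simp only [hG, AddCircle.coe_equivIco_mk_apply, div_one, mul_one]
    rw [(hp.exists_mem_unitCube x).2]
  have hq : IsOpenQuotientMap
      (Pi.map fun (_ : Fin d) (x : ℝ) => (x : UnitAddCircle)) :=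
    IsOpenQuotientMap.piMap fun _ => QuotientAddGroup.isOpenQuotientMap_mk
  refine ⟨⟨G, hq.continuous_comp_iff.1 ?_⟩, hval⟩
  have : G ∘ (Pi.map fun (_ : Fin d) (x : ℝ) => (x : UnitAddCircle)) = fun x => (F x : ℂ) :=
    funext hval
  rw [this]
  exact Complex.continuous_ofReal.comp hF

/-- The normalized Haar measure used by Mathlib for Fourier series on `UnitAddTorus`. -/
local instance measureSpaceUnitAddCircle : MeasureSpace UnitAddCircle := ⟨AddCircle.haarAddCircle⟩

local instance isProbabilityMeasureUnitAddCircle :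
    IsProbabilityMeasure (volume : Measure UnitAddCircle) :=
  inferInstanceAs (IsProbabilityMeasure AddCircle.haarAddCircle)

/-- Parseval's identity on the fundamental domain. -/
theorem hasSum_sq_norm_cubeCoeff {F : (Fin d → ℝ) → ℝ} (hF : Continuous F) (hp : ZPer F) :
    HasSum (fun n => ‖cubeCoeff F n‖ ^ 2) (∫ x in unitCube d, F x ^ 2) := by
  obtain ⟨Ft, hFt⟩ := exists_lift_unitAddTorus hF hp
  have h := hasSum_sq_mFourierCoeff (ContinuousMap.toLp 2 volume ℂ Ft)
  simp only [mFourierCoeff_toLp, mFourierCoeff_eq_cubeCoeff hFt] at h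
  have h2 : ∫ t, ‖ContinuousMap.toLp 2 volume ℂ Ft t‖ ^ 2 = ∫ x in unitCube d, F x ^ 2 := by
    have : ∫ t, ‖ContinuousMap.toLp 2 volume ℂ Ft t‖ ^ 2 = ∫ t, ‖Ft t‖ ^ 2 :=
      integral_congr_ae (by
        filter_upwards [ContinuousMap.coeFn_toLp (p := 2) (𝕜 := ℂ) volume Ft] with t ht
        rw [ht])
    rw [this, integral_preimage _ 0, setIntegral_piIoc_eq]
    simp [hFt]
  rwa [h2] at h

theorem norm_le_tsum_of_summable_cubeCoeff {F : (Fin d → ℝ) → ℝ} (hF : Continuous F)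
    (hp : ZPer F) (hs : Summable fun n => ‖cubeCoeff F n‖) (x : Fin d → ℝ) :
    |F x| ≤ ∑' n, ‖cubeCoeff F n‖ := by
  obtain ⟨Ft, hFt⟩ := exists_lift_unitAddTorus hF hp
  have hc : mFourierCoeff Ft = cubeCoeff F := funext (mFourierCoeff_eq_cubeCoeff hFt)
  have hsum := hasSum_mFourier_series_apply_of_summable (f := Ft) (by rw [hc]; exact hs.of_norm)
    (fun i => (x i : UnitAddCircle))
  rw [hFt, hc] at hsum
  have hle : ∀ n : Fin d → ℤ, ‖cubeCoeff F n • mFourier n (fun i => (x i : UnitAddCircle))‖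
      ≤ ‖cubeCoeff F n‖ := by
    intro n
    rw [norm_smul]
    refine mul_le_of_le_one_right (norm_nonneg _) ?_
    exact (ContinuousMap.norm_coe_le_norm _ _).trans mFourier_norm.le
  have := tsum_of_norm_bounded hs.hasSum hle
  rwa [hsum.tsum_eq, Complex.norm_real, Real.norm_eq_abs] at this

theorem cubeCoeff_pder {F : (Fin d → ℝ) → ℝ} (hF : ContDiff ℝ ∞ F) (hp : ZPer F) (i : Fin d)
    (n : Fin d → ℤ) : cubeCoeff (pder i F) n = 2 * π * Complex.I * n i * cubeCoeff F n := by
  have hdF := hF.differentiable (by simp)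
  set g : (Fin d → ℝ) → ℂ := fun x => Complex.exp (fourierPhase n x) * F x with hg
  have hexp : ∀ x, HasFDerivAt (fun y => Complex.exp (fourierPhase n y))
      (Complex.exp (fourierPhase n x) • fourierPhase n) x :=
    fun x => (fourierPhase n).hasFDerivAt.cexp
  have hFd : ∀ x, HasFDerivAt (fun y => (F y : ℂ)) (Complex.ofRealCLM.comp (fderiv ℝ F x)) x :=
    fun x => Complex.ofRealCLM.hasFDerivAt.comp x (hdF x).hasFDerivAt
  have hgs : ContDiff ℝ 1 g :=
    (Complex.contDiff_exp.comp (fourierPhase n).contDiff).mul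
      (Complex.ofRealCLM.contDiff.comp (hF.of_le (by simp)))
  have hper : ∀ (x : Fin d → ℝ) (k : Fin d → ℤ), g (fun i => x i + (k i : ℝ)) = g x := by
    intro x k
    simp only [hg, hp x k]
    congr 1
    rw [← mFourier_neg_coe, ← mFourier_neg_coe]
    congr 1
    funext j
    simp
  have hderiv : ∀ x, fderiv ℝ g x (Pi.single i 1)
      = Complex.exp (fourierPhase n x) * pder i F x
        + -(2 * π * Complex.I * n i) * (Complex.exp (fourierPhase n x) * F x) := by
    intro x
    rw [((hexp x).fun_mul (hFd x)).fderiv, pder_eq_fderiv hdF]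
    simp [fourierPhase_single]
    ring
  have hce : Continuous fun x => Complex.exp (fourierPhase n x) :=
    Complex.continuous_exp.comp (fourierPhase n).continuous
  have hcF : Continuous fun x => (F x : ℂ) := Complex.continuous_ofReal.comp hF.continuous
  have hcdF : Continuous fun x => (pder i F x : ℂ) :=
    Complex.continuous_ofReal.comp (hF.pder i).continuous
  have h := integral_fderiv_single_eq_zero hgs hper i
  simp only [hderiv] at h
  rw [integral_add (hce.fun_mul hcdF).integrableOn_unitCube
    ((hce.fun_mul hcF).integrableOn_unitCube.const_mul _), integral_const_mul] at h
  rw [cubeCoeff, cubeCoeff]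
  linear_combination h

theorem ContDiff.foldr_pder {F : (Fin d → ℝ) → ℝ} (hF : ContDiff ℝ ∞ F) (l : List (Fin d)) :
    ContDiff ℝ ∞ (l.foldr _root_.pder F) := by
  induction l with
  | nil => exact hF
  | cons i l ih => exact ih.pder i

theorem ZPer.foldr_pder {F : (Fin d → ℝ) → ℝ} (hp : ZPer F) (l : List (Fin d)) :
    ZPer (l.foldr _root_.pder F) := by
  induction l with
  | nil => exact hp
  | cons i l ih => exact ih.pder i

theorem norm_cubeCoeff_foldr_pder {F : (Fin d → ℝ) → ℝ} (hF : ContDiff ℝ ∞ F) (hp : ZPer F)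
    (l : List (Fin d)) (n : Fin d → ℤ) : ‖cubeCoeff (l.foldr pder F) n‖
      = (l.map fun i => 2 * π * |(n i : ℝ)|).prod * ‖cubeCoeff F n‖ := by
  induction l with
  | nil => simp
  | cons i l ih =>
    rw [List.foldr_cons, cubeCoeff_pder (hF.foldr_pder l) (hp.foldr_pder l), norm_mul, ih,
      List.map_cons, List.prod_cons, ← mul_assoc]
    simp [abs_of_pos pi_pos]

/-- The weight `max 1 |n|` on frequencies. -/
def freqWeight (n : Fin d → ℤ) : ℝ := max 1 ‖fun i => (n i : ℝ)‖

theorem one_le_freqWeight (n : Fin d → ℤ) : 1 ≤ freqWeight n := le_max_left _ _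

theorem abs_le_freqWeight (n : Fin d → ℤ) (i : Fin d) : |(n i : ℝ)| ≤ freqWeight n :=
  (norm_le_pi_norm (fun i => (n i : ℝ)) i).trans (le_max_right _ _)

theorem freqWeight_pow_le (n : Fin d → ℤ) (k : ℕ) :
    freqWeight n ^ k ≤ 1 + ∑ i, |(n i : ℝ)| ^ k := by
  have h0 : 0 ≤ ∑ i, |(n i : ℝ)| ^ k := Finset.sum_nonneg fun i _ => by positivity
  rcases le_total ‖fun i => (n i : ℝ)‖ 1 with h | h
  · rw [freqWeight, max_eq_left h, one_pow]
    linarith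
  · have : Nonempty (Fin d) := by
      by_contra hne
      rw [not_nonempty_iff] at hne
      rw [Subsingleton.elim (fun i => (n i : ℝ)) 0, norm_zero] at h
      linarith
    obtain ⟨i, hi⟩ := Finite.exists_max fun i => |(n i : ℝ)|
    have hn : ‖fun i => (n i : ℝ)‖ ≤ |(n i : ℝ)| := (pi_norm_le_iff_of_nonneg (abs_nonneg _)).2 hi
    rw [freqWeight, max_eq_right h]
    have h1 : ‖fun i => (n i : ℝ)‖ ^ k ≤ |(n i : ℝ)| ^ k := by gcongr
    have h2 := Finset.single_le_sum (f := fun i => |(n i : ℝ)| ^ k)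
      (fun i _ => by positivity) (Finset.mem_univ i)
    linarith

theorem summable_inv_freqWeight_pow {k : ℕ} (hk : d < k) :
    Summable fun n : Fin d → ℤ => (freqWeight n)⁻¹ ^ k := by
  set b := Pi.basisFun ℝ (Fin d)
  set L := Submodule.span ℤ (Set.range b) with hL
  have hrank : Module.finrank ℤ L = d := by
    rw [ZLattice.rank ℝ L]
    simp
  have hmem : ∀ n : Fin d → ℤ, (fun i => (n i : ℝ)) ∈ L := by
    intro n
    rw [hL, b.mem_span_iff_repr_mem ℤ]
    exact fun i => ⟨n i, by simp [b]⟩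
  have hs := ZLattice.summable_norm_pow_inv L k (by rw [hrank]; exact hk)
  have hinj : Function.Injective fun n : Fin d → ℤ => (⟨fun i => (n i : ℝ), hmem n⟩ : L) := by
    intro m n h
    funext i
    exact Int.cast_injective (congrFun (congrArg Subtype.val h) i)
  refine Summable.of_norm_bounded_eventually (hs.comp_injective hinj) ?_
  refine (Set.finite_singleton (0 : Fin d → ℤ)).subset fun n hn => ?_
  by_contra hne
  refine hn ?_
  obtain ⟨i, hi⟩ := Function.ne_iff.1 (show n ≠ 0 from hne)
  have h1 : 1 ≤ ‖fun i => (n i : ℝ)‖ := by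
    refine le_trans ?_ (norm_le_pi_norm (fun i => (n i : ℝ)) i)
    rw [Real.norm_eq_abs]
    exact_mod_cast Int.one_le_abs hi
  have h2 : 0 ≤ (freqWeight n)⁻¹ := inv_nonneg.2 (zero_le_one.trans (one_le_freqWeight n))
  change ‖(freqWeight n)⁻¹ ^ k‖ ≤ ‖fun i => (n i : ℝ)‖⁻¹ ^ k
  rw [Real.norm_of_nonneg (by positivity), freqWeight, max_eq_right h1]

theorem integral_sq_foldr_pder_le_hSobSq (F : (Fin d → ℝ) → ℝ) {β k : ℕ} (hk : k ≤ β)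
    (i : Fin d) :
    ∫ x in unitCube d, (List.replicate k i).foldr pder F x ^ 2 ≤ hSobSq β F := by
  set j : Fin d → Fin (β + 1) := Pi.single i ⟨k, by omega⟩ with hj
  have hjv : ∀ m, (j m : ℕ) = if m = i then k else 0 := by
    intro m
    by_cases h : m = i
    · subst h; simp [hj]
    · simp [hj, h]
  have hsum : ∑ m, (j m : ℕ) = k := by simp [hjv]
  obtain ⟨l, hl, hmem, h⟩ := exists_mder_eq_foldr (fun m => (j m : ℕ)) F
  have hrep : l = List.replicate k i := by
    refine List.eq_replicate_iff.2 ⟨hl.trans hsum, fun m hm => ?_⟩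
    by_contra hne
    exact hmem m hm (by rw [hjv, if_neg hne])
  rw [← hrep, ← h]
  exact Finset.single_le_sum
    (f := fun j : Fin d → Fin (β + 1) => ∫ x in unitCube d, mder (fun i => (j i : ℕ)) F x ^ 2)
    (fun j _ => integral_nonneg fun x => sq_nonneg _)
    (Finset.mem_filter.2 ⟨Finset.mem_univ _, by rw [hsum]; exact hk⟩)

/-- Weighted square summability of the Fourier coefficients of an `H^β` function. -/
theorem weighted_sq_cubeCoeff_le (hd : 1 ≤ d) {F : (Fin d → ℝ) → ℝ} (hF : ContDiff ℝ ∞ F)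
    (hp : ZPer F) (β : ℕ) :
    (Summable fun n => (freqWeight n ^ β * ‖cubeCoeff F n‖) ^ 2) ∧
      ∑' n, (freqWeight n ^ β * ‖cubeCoeff F n‖) ^ 2 ≤ (d + 1) * hSobSq β F := by
  have hpar : ∀ (k : ℕ) (i : Fin d),
      HasSum (fun n => ((2 * π * |(n i : ℝ)|) ^ k * ‖cubeCoeff F n‖) ^ 2)
        (∫ x in unitCube d, (List.replicate k i).foldr pder F x ^ 2) := by
    intro k i
    have h := hasSum_sq_norm_cubeCoeff (hF.foldr_pder (List.replicate k i)).continuous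
      (hp.foldr_pder _)
    simpa only [norm_cubeCoeff_foldr_pder hF hp, List.map_replicate, List.prod_replicate] using h
  have h0 := hpar 0 ⟨0, hd⟩
  have hall := hasSum_sum fun i (_ : i ∈ Finset.univ) => hpar β i
  have htot := h0.add hall
  have hle : ∀ n : Fin d → ℤ, (freqWeight n ^ β * ‖cubeCoeff F n‖) ^ 2
      ≤ ((2 * π * |(n ⟨0, hd⟩ : ℝ)|) ^ 0 * ‖cubeCoeff F n‖) ^ 2
        + ∑ i, ((2 * π * |(n i : ℝ)|) ^ β * ‖cubeCoeff F n‖) ^ 2 := by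
    intro n
    have h1 := mul_le_mul_of_nonneg_right (freqWeight_pow_le n (β * 2))
      (sq_nonneg ‖cubeCoeff F n‖)
    have h2 : ∑ i, |(n i : ℝ)| ^ (β * 2) * ‖cubeCoeff F n‖ ^ 2
        ≤ ∑ i, ((2 * π * |(n i : ℝ)|) ^ β * ‖cubeCoeff F n‖) ^ 2 := by
      refine Finset.sum_le_sum fun i _ => ?_
      rw [mul_pow, ← pow_mul]
      have : |(n i : ℝ)| ≤ 2 * π * |(n i : ℝ)| :=
        le_mul_of_one_le_left (abs_nonneg _) (by linarith [pi_gt_three])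
      gcongr
    rw [mul_pow, ← pow_mul, pow_zero, one_mul]
    rw [add_mul, Finset.sum_mul, one_mul] at h1
    linarith
  have hsum : Summable fun n => (freqWeight n ^ β * ‖cubeCoeff F n‖) ^ 2 :=
    .of_nonneg_of_le (fun n => sq_nonneg _) hle htot.summable
  refine ⟨hsum, (hasSum_le hle hsum.hasSum htot).trans ?_⟩
  have h3 := Finset.sum_le_card_nsmul Finset.univ _ _ fun i (_ : i ∈ Finset.univ) =>
    integral_sq_foldr_pder_le_hSobSq F (le_refl β) i
  rw [Finset.card_univ, Fintype.card_fin, nsmul_eq_mul] at h3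
  linarith [integral_sq_foldr_pder_le_hSobSq F (Nat.zero_le β) ⟨0, hd⟩]

/-- Sobolev embedding `H^β ⊂ C²` on the torus for `β > 2 + d/2`. -/
theorem exists_C2_bound_of_hSob_le (hd : 1 ≤ d) {β : ℕ} (hβ : 2 + (d : ℝ) / 2 < (β : ℝ))
    (R : ℝ) : ∃ C, 0 ≤ C ∧ ∀ F : (Fin d → ℝ) → ℝ, ContDiff ℝ ∞ F → ZPer F → hSob β F ≤ R →
      ∀ l : List (Fin d), l.length ≤ 2 → ∀ x, |l.foldr pder F x| ≤ C := by
  obtain ⟨γ, rfl⟩ : ∃ γ, β = 2 + γ := by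
    refine Nat.exists_eq_add_of_le ?_
    have : (2 : ℝ) ≤ β := by linarith [show (0 : ℝ) ≤ (d : ℝ) / 2 by positivity]
    exact_mod_cast this
  have hγ : d < γ * 2 := by
    push_cast at hβ
    have : (d : ℝ) < γ * 2 := by linarith
    exact_mod_cast this
  have hS := summable_inv_freqWeight_pow hγ
  set S := ∑' n : Fin d → ℤ, (freqWeight n)⁻¹ ^ (γ * 2)
  have hS0 : 0 ≤ S := tsum_nonneg fun n =>
    pow_nonneg (inv_nonneg.2 (zero_le_one.trans (one_le_freqWeight n))) _
  refine ⟨(2 * π) ^ 2 * ((d + 1) * R ^ 2 + S), by positivity, fun F hF hp hR l hl x => ?_⟩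
  have hR2 : hSobSq (2 + γ) F ≤ R ^ 2 := (Real.sqrt_le_left ((Real.sqrt_nonneg _).trans hR)).1 hR
  obtain ⟨hsum, hW⟩ := weighted_sq_cubeCoeff_le hd hF hp (2 + γ)
  have hle : ∀ n, ‖cubeCoeff (l.foldr pder F) n‖
      ≤ (2 * π) ^ 2 * ((freqWeight n ^ (2 + γ) * ‖cubeCoeff F n‖) ^ 2
        + (freqWeight n)⁻¹ ^ (γ * 2)) := by
    intro n
    have hρ := one_le_freqWeight n
    have hρ0 : 0 < freqWeight n := zero_lt_one.trans_le hρ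
    have h1 : (l.map fun i => 2 * π * |(n i : ℝ)|).prod ≤ (2 * π * freqWeight n) ^ l.length := by
      clear hl
      induction l with
      | nil => simp
      | cons i l ih =>
        rw [List.map_cons, List.prod_cons, List.length_cons, pow_succ']
        have hnn : 0 ≤ (l.map fun i => 2 * π * |(n i : ℝ)|).prod :=
          List.prod_nonneg (by simp only [List.mem_map]; rintro _ ⟨k, -, rfl⟩; positivity)
        have := abs_le_freqWeight n i
        gcongr
    have h2 : (2 * π * freqWeight n) ^ l.length ≤ (2 * π * freqWeight n) ^ 2 :=
      pow_le_pow_right₀ (one_le_mul_of_one_le_of_one_le (by linarith [pi_gt_three]) hρ) hl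
    have h3 : freqWeight n ^ 2 * ‖cubeCoeff F n‖
        = freqWeight n ^ (2 + γ) * ‖cubeCoeff F n‖ * (freqWeight n)⁻¹ ^ γ := by
      rw [inv_pow, pow_add]
      field_simp
    rw [norm_cubeCoeff_foldr_pder hF hp]
    calc (l.map fun i => 2 * π * |(n i : ℝ)|).prod * ‖cubeCoeff F n‖
        ≤ (2 * π * freqWeight n) ^ 2 * ‖cubeCoeff F n‖ :=
          mul_le_mul_of_nonneg_right (h1.trans h2) (norm_nonneg _)
      _ = (2 * π) ^ 2 * (freqWeight n ^ (2 + γ) * ‖cubeCoeff F n‖ * (freqWeight n)⁻¹ ^ γ) := by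
          rw [← h3]; ring
      _ ≤ _ := by
          rw [pow_mul (freqWeight n)⁻¹]
          gcongr
          set a := freqWeight n ^ (2 + γ) * ‖cubeCoeff F n‖
          set c := (freqWeight n)⁻¹ ^ γ
          nlinarith [sq_nonneg (a - c), sq_nonneg a, sq_nonneg c]
  have hmaj := (hsum.hasSum.add hS.hasSum).mul_left ((2 * π) ^ 2)
  have hsl : Summable fun n => ‖cubeCoeff (l.foldr pder F) n‖ :=
    .of_nonneg_of_le (fun n => norm_nonneg _) hle hmaj.summable
  refine (norm_le_tsum_of_summable_cubeCoeff (hF.foldr_pder l).continuous (hp.foldr_pder l) hsl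
    x).trans ((hasSum_le hle hsl.hasSum hmaj).trans ?_)
  gcongr
  exact hW.trans (by gcongr)

end SobolevEmbedding

noncomputable section LipschitzDependence

variable {d : ℕ} {T : ℝ}

theorem SmoothQ.sub {u v : (Fin d → ℝ) → ℝ → ℝ} (hu : SmoothQ u) (hv : SmoothQ v) :
    SmoothQ fun x t => u x t - v x t := ContDiff.sub hu hv

theorem ZPerSpace.sub {u v : (Fin d → ℝ) → ℝ → ℝ} (hu : ZPerSpace u) (hv : ZPerSpace v) :
    ZPerSpace fun x t => u x t - v x t := fun t x k => by simp only [hu t x k, hv t x k]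

theorem dt_sub {u v : (Fin d → ℝ) → ℝ → ℝ} (hu : SmoothQ u) (hv : SmoothQ v) (x : Fin d → ℝ)
    (t : ℝ) : dt (fun y s => u y s - v y s) x t = dt u x t - dt v x t :=
  ((hu.hasDerivAt_dt x t).fun_sub (hv.hasDerivAt_dt x t)).deriv

theorem lapQ_sub {u v : (Fin d → ℝ) → ℝ → ℝ} (hu : SmoothQ u) (hv : SmoothQ v) (x : Fin d → ℝ)
    (t : ℝ) : lapQ (fun y s => u y s - v y s) x t = lapQ u x t - lapQ v x t := by
  have h : ∀ i, dx i (fun y s => u y s - v y s) = fun y s => dx i u y s - dx i v y s := fun i => by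
    funext y s
    exact pder_sub (hu.space_differentiable s) (hv.space_differentiable s) i y
  simp only [lapQ, h, ← Finset.sum_sub_distrib]
  exact Finset.sum_congr rfl fun i _ =>
    pder_sub ((hu.dx i).space_differentiable t) ((hv.dx i).space_differentiable t) i x

/-- Uniform bounds on `Φ ∘ F` and its derivatives when `F` is bounded in `C²`. -/
theorem LinkFun.exists_comp_bounds (Φ : LinkFun) {C : ℝ} (hC : 0 ≤ C) :
    ∃ K L, 0 ≤ K ∧ (∀ a b, |Φ.toFun a - Φ.toFun b| ≤ L * |a - b|) ∧
      ∀ F : (Fin d → ℝ) → ℝ, ContDiff ℝ ∞ F →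
        (∀ l : List (Fin d), l.length ≤ 2 → ∀ x, |l.foldr pder F x| ≤ C) →
        (∀ x, Φ.toFun (F x) ≤ K) ∧ (∀ i x, |pder i (fun y => Φ.toFun (F y)) x| ≤ K) ∧
          ∀ i x, |pder i (pder i fun y => Φ.toFun (F y)) x| ≤ K := by
  obtain ⟨L, hL⟩ := Φ.derivs_bdd 1 le_rfl
  obtain ⟨M, hM⟩ := Φ.derivs_bdd 2 one_le_two
  rw [iteratedDeriv_one] at hL
  have hM' : ∀ x, |deriv (deriv Φ.toFun) x| ≤ M := by
    intro x
    have h := hM x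
    rwa [iteratedDeriv_succ, iteratedDeriv_one] at h
  have hL0 : 0 ≤ L := (abs_nonneg _).trans (hL 0)
  have hM0 : 0 ≤ M := (abs_nonneg _).trans (hM 0)
  have hΦ : Differentiable ℝ Φ.toFun := Φ.smooth.differentiable (by simp)
  have hΦ' : Differentiable ℝ (deriv Φ.toFun) :=
    (contDiff_infty_iff_deriv.1 Φ.smooth).2.differentiable (by simp)
  have hLip : ∀ a b, |Φ.toFun a - Φ.toFun b| ≤ L * |a - b| := fun a b =>
    Convex.norm_image_sub_le_of_norm_deriv_le (fun x _ => hΦ x) (fun x _ => hL x) convex_univ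
      (Set.mem_univ b) (Set.mem_univ a)
  refine ⟨|Φ.toFun 0| + L * C + M * C * C, L, by positivity, hLip, fun F hF hb => ?_⟩
  have hdF := hF.differentiable (by simp)
  have h0 : ∀ x, |F x| ≤ C := hb [] (by simp)
  have h1 : ∀ i x, |pder i F x| ≤ C := fun i => hb [i] (by simp)
  have h2 : ∀ i x, |pder i (pder i F) x| ≤ C := fun i => hb [i, i] (by simp)
  have hp : ∀ i, pder i (fun y => Φ.toFun (F y)) = fun y => deriv Φ.toFun (F y) * pder i F y :=
    fun i => funext (pder_comp hΦ hdF i)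
  have hLC : 0 ≤ L * C := by positivity
  have hMC : 0 ≤ M * C * C := by positivity
  refine ⟨fun x => ?_, fun i x => ?_, fun i x => ?_⟩
  · have ha := hLip (F x) 0
    rw [sub_zero] at ha
    have hm := mul_le_mul_of_nonneg_left (h0 x) hL0
    linarith [le_abs_self (Φ.toFun (F x) - Φ.toFun 0), le_abs_self (Φ.toFun 0)]
  · rw [hp, abs_mul]
    have := mul_le_mul (hL (F x)) (h1 i x) (abs_nonneg _) hL0
    linarith [abs_nonneg (Φ.toFun 0)]
  · have hdΦF : Differentiable ℝ fun y => deriv Φ.toFun (F y) := hΦ'.comp hdF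
    rw [hp, pder_mul hdΦF ((hF.pder i).differentiable (by simp)), pder_comp hΦ' hdF]
    have ha := mul_le_mul (mul_le_mul (hM' (F x)) (h1 i x) (abs_nonneg _) hM0) (h1 i x)
      (abs_nonneg _) (by positivity)
    have hb := mul_le_mul (hL (F x)) (h2 i x) (abs_nonneg _) hL0
    refine (abs_add_le _ _).trans ?_
    simp only [abs_mul]
    linarith [abs_nonneg (Φ.toFun 0)]

theorem integral_muQ_sq_mul_le (hT : 0 ≤ T) {h : (Fin d → ℝ) → ℝ} (hh : Continuous h)
    {q : (Fin d → ℝ) → ℝ → ℝ} (hq : SmoothQ q) {B : ℝ}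
    (hB : ∀ x, ∀ t ∈ Set.Ioc 0 T, |q x t| ≤ B) :
    ∫ p, (h p.1 * q p.1 p.2) ^ 2 ∂muQ d T ≤ T * (B ^ 2 * ∫ x in unitCube d, h x ^ 2) := by
  have hc : Continuous fun p : (Fin d → ℝ) × ℝ => B ^ 2 * h p.1 ^ 2 := by fun_prop
  have hh1 : Continuous fun p : (Fin d → ℝ) × ℝ => h p.1 := by fun_prop
  refine (integral_muQ_mono ((hh1.fun_mul hq.continuous).fun_pow 2) hc fun x t ht => ?_).trans ?_
  · simp only [mul_pow]
    rw [mul_comm]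
    exact mul_le_mul_of_nonneg_right (sq_le_sq' (abs_le.1 (hB x t ht)).1 (abs_le.1 (hB x t ht)).2)
      (sq_nonneg _)
  · rw [integral_muQ_eq_symm hc]
    simp [integral_const_mul, hT]

/-- Maximal regularity with constants uniform over bounded absorptions. -/
theorem exists_inhomSol_bound (hT : 0 ≤ T) {a m : ℝ} (ha : 0 < a) (hm : 0 < m) (K : ℝ) :
    ∃ P, 0 ≤ P ∧ ∀ θ, a ≤ θ → ∀ f : (Fin d → ℝ) → ℝ, (∀ x, m ≤ f x) → (∀ x, f x ≤ K) →
      ∀ g v : (Fin d → ℝ) → ℝ → ℝ, (Continuous fun p : (Fin d → ℝ) × ℝ => g p.1 p.2) →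
        InhomSol T θ f g v →
        ∫ p, v p.1 p.2 ^ 2 ∂muQ d T ≤ P * ∫ p, g p.1 p.2 ^ 2 ∂muQ d T ∧
        ∫ p, lapQ v p.1 p.2 ^ 2 ∂muQ d T ≤ P * ∫ p, g p.1 p.2 ^ 2 ∂muQ d T ∧
        ∫ p, dt v p.1 p.2 ^ 2 ∂muQ d T ≤ P * ∫ p, g p.1 p.2 ^ 2 ∂muQ d T := by
  set κ := 2 + 2 * K ^ 2 / m ^ 2 with hκ
  have hκ0 : 0 ≤ κ := by positivity
  refine ⟨1 / m ^ 2 + κ + 4 * κ / a ^ 2, by positivity, fun θ hθ f hfm hfK g v hg hv => ?_⟩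
  obtain ⟨h1, h2⟩ := energy_estimates hT (ha.trans_le hθ) hm hfm hfK hg hv
  have hV0 : 0 ≤ ∫ p, v p.1 p.2 ^ 2 ∂muQ d T := integral_nonneg fun _ => sq_nonneg _
  have hL0 : 0 ≤ ∫ p, lapQ v p.1 p.2 ^ 2 ∂muQ d T := integral_nonneg fun _ => sq_nonneg _
  have hD0 : 0 ≤ ∫ p, dt v p.1 p.2 ^ 2 ∂muQ d T := integral_nonneg fun _ => sq_nonneg _
  have hG0 : 0 ≤ ∫ p, g p.1 p.2 ^ 2 ∂muQ d T := integral_nonneg fun _ => sq_nonneg _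
  set V := ∫ p, v p.1 p.2 ^ 2 ∂muQ d T
  set L := ∫ p, lapQ v p.1 p.2 ^ 2 ∂muQ d T
  set D := ∫ p, dt v p.1 p.2 ^ 2 ∂muQ d T
  set G := ∫ p, g p.1 p.2 ^ 2 ∂muQ d T
  have hV : V ≤ 1 / m ^ 2 * G := by
    rw [one_div, inv_mul_eq_div, le_div_iff₀ (by positivity)]
    linarith
  have hrhs : 2 * G + 2 * K ^ 2 * V ≤ κ * G := by
    have := mul_le_mul_of_nonneg_left hV (show 0 ≤ 2 * K ^ 2 by positivity)
    calc 2 * G + 2 * K ^ 2 * V ≤ 2 * G + 2 * K ^ 2 * (1 / m ^ 2 * G) := by linarith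
      _ = κ * G := by rw [hκ]; ring
  have hθ2 : a ^ 2 ≤ θ ^ 2 := by gcongr
  have hLa : L ≤ 4 * κ / a ^ 2 * G := by
    have h3 := mul_le_mul_of_nonneg_right hθ2 hL0
    rw [div_mul_eq_mul_div, le_div_iff₀ (by positivity)]
    linarith
  have hD : D ≤ κ * G := by
    have : 0 ≤ θ ^ 2 / 4 * L := by positivity
    linarith
  have t1 : 0 ≤ 1 / m ^ 2 * G := by positivity
  have t2 : 0 ≤ κ * G := by positivity
  have t3 : 0 ≤ 4 * κ / a ^ 2 * G := by positivity
  rw [add_mul, add_mul]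
  exact ⟨by linarith, by linarith, by linarith⟩

theorem l2T_sq (G : (Fin d → ℝ) → ℝ) : l2T G ^ 2 = ∫ x in unitCube d, G x ^ 2 :=
  Real.sq_sqrt (integral_nonneg fun _ => sq_nonneg _)

end LipschitzDependence

/-- Lipschitz dependence of `K̇_θ F` on `F`
(Lemma `bounds`, item (iv)). -/
theorem theta_derivative_lipschitz_in_F {d : ℕ} (hd : 1 ≤ d) (T θmin θmax : ℝ)
    (hT : 0 < T) (hθmin : 0 < θmin) (hθ : θmin ≤ θmax) (Φ : LinkFun)
    (u0 : (Fin d → ℝ) → ℝ) (hu0 : ContDiff ℝ (⊤ : ℕ∞) u0) (hu0per : ZPer u0)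
    (β : ℕ) (hβ : 2 + (d : ℝ) / 2 < (β : ℝ)) (R : ℝ) (hR : 0 < R) :
    ∃ D > (0 : ℝ), ∀ θ ∈ Set.Icc θmin θmax,
      ∀ F F₀ : (Fin d → ℝ) → ℝ,
      ContDiff ℝ (⊤ : ℕ∞) F → ZPer F → hSob β F ≤ R →
      ContDiff ℝ (⊤ : ℕ∞) F₀ → ZPer F₀ → hSob β F₀ ≤ R →
      ∀ uF uF₀ wF wF₀ : (Fin d → ℝ) → ℝ → ℝ,
        HeatSol T θ (fun x => Φ.toFun (F x)) u0 uF →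
        HeatSol T θ (fun x => Φ.toFun (F₀ x)) u0 uF₀ →
        ThetaDerivSol T θ Φ F uF wF →
        ThetaDerivSol T θ Φ F₀ uF₀ wF₀ →
        h21 T (fun x t => wF x t - wF₀ x t)
          ≤ D * l2T (fun x => F x - F₀ x) * (1 + supT F) := by
  obtain ⟨C, hC, hSob⟩ := exists_C2_bound_of_hSob_le hd hβ R
  obtain ⟨K, L, hK, hLip, hcomp⟩ := Φ.exists_comp_bounds (d := d) hC
  obtain ⟨B, hB, hheat⟩ := exists_bound_heatSol hT.le hu0 hu0per hK
  obtain ⟨P, hP, hmax⟩ := exists_inhomSol_bound (d := d) hT.le hθmin Φ.fmin_pos K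
  obtain ⟨N, hN, hh21⟩ := exists_h21Sq_le d
  set A := d * B / 2 * T with hA
  set E := (2 * N + 2) * P * (2 * (T * A ^ 2) + 1 / 2 * (P * (T * B ^ 2))) * L ^ 2 with hE
  have hE0 : 0 ≤ E := by positivity
  refine ⟨√E + 1, by positivity, ?_⟩
  rintro θ ⟨hθ1, -⟩ F F₀ hF hFp hFR hF₀ hF₀p hF₀R u u₀ w w₀ hu hu₀ ⟨hw, hwp, hwe, hwi⟩
    ⟨hw₀, hw₀p, hw₀e, hw₀i⟩
  have hθ0 : 0 ≤ θ := hθmin.le.trans hθ1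
  obtain ⟨hfK, -, -⟩ := hcomp F hF (hSob F hF hFp hFR)
  obtain ⟨-, hf₀1, hf₀2⟩ := hcomp F₀ hF₀ (hSob F₀ hF₀ hF₀p hF₀R)
  have hpos : ∀ y, 0 ≤ Φ.toFun y := fun y => (Φ.fmin_pos.trans (Φ.gt_fmin y)).le
  have hub := hheat θ hθ0 _ (Φ.smooth.comp hF₀) (fun x => hpos _) hf₀1 hf₀2 u₀ hu₀
  obtain ⟨hus, hup, hue, hui⟩ := hu
  obtain ⟨hu₀s, hu₀p, hu₀e, hu₀i⟩ := hu₀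
  have hwb : ∀ x, ∀ t ∈ Set.Ioc 0 T, |w₀ x t| ≤ A := by
    intro x t ht
    have h := abs_le_of_solution (A := 0) (M := d * B / 2) hT.le hθ0 le_rfl (by positivity)
      (fun x => hpos (F₀ x)) hw₀ hw₀p hw₀e (fun y s hs => ?_) (fun y => by rw [hw₀i, abs_zero]) x
      (Set.Ioc_subset_Icc_self ht)
    · rwa [zero_add] at h
    · have hl : |lapQ u₀ y s| ≤ d * B := by
        refine (Finset.abs_sum_le_sum_abs _ _).trans ?_
        refine (Finset.sum_le_card_nsmul _ _ B fun i _ =>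
          (hub y s (Set.Ioc_subset_Icc_self hs)).2 i).trans_eq ?_
        simp
      change |1 / 2 * lapQ u₀ y s| ≤ _
      rw [abs_mul, abs_of_pos one_half_pos]
      linarith
  set h : (Fin d → ℝ) → ℝ := fun x => Φ.toFun (F x) - Φ.toFun (F₀ x) with hh
  have hhs : ContDiff ℝ ∞ h := (Φ.smooth.comp hF).sub (Φ.smooth.comp hF₀)
  have hhc := hhs.continuous
  have hhc1 : Continuous fun p : (Fin d → ℝ) × ℝ => h p.1 := by fun_prop
  have hS : ∫ x in unitCube d, h x ^ 2 ≤ L ^ 2 * l2T (fun x => F x - F₀ x) ^ 2 := by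
    rw [l2T_sq, ← integral_const_mul]
    have hFF : Continuous fun x => F x - F₀ x := hF.continuous.sub hF₀.continuous
    refine integral_mono (hhc.fun_pow 2).integrableOn_unitCube
      ((hFF.fun_pow 2).const_mul _).integrableOn_unitCube fun x => ?_
    have := pow_le_pow_left₀ (abs_nonneg _) (hLip (F x) (F₀ x)) 2
    rwa [mul_pow, sq_abs, sq_abs] at this
  set S := ∫ x in unitCube d, h x ^ 2
  set U : (Fin d → ℝ) → ℝ → ℝ := fun x t => u x t - u₀ x t with hU
  set W : (Fin d → ℝ) → ℝ → ℝ := fun x t => w x t - w₀ x t with hW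
  have hUs : SmoothQ U := hus.sub hu₀s
  have hWs : SmoothQ W := hw.sub hw₀
  have hUsol : InhomSol T θ (fun x => Φ.toFun (F x)) (fun x t => -(h x * u₀ x t)) U := by
    refine ⟨hUs, hup.sub hu₀p, fun x t ht => ?_, fun x => by simp [hU, hui, hu₀i]⟩
    have e1 : dt u x t = _ := hue x t ht
    have e2 : dt u₀ x t = _ := hu₀e x t ht
    change dt U x t = θ / 2 * lapQ U x t - Φ.toFun (F x) * U x t + -(h x * u₀ x t)
    rw [dt_sub hus hu₀s, lapQ_sub hus hu₀s, e1, e2, hU, hh]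
    change θ / 2 * lapQ u x t - _ - (θ / 2 * lapQ u₀ x t - _) = _
    ring
  have hWsol : InhomSol T θ (fun x => Φ.toFun (F x))
      (fun x t => -(h x * w₀ x t) + 1 / 2 * lapQ U x t) W := by
    refine ⟨hWs, hwp.sub hw₀p, fun x t ht => ?_, fun x => by simp [hW, hwi, hw₀i]⟩
    have e1 : dt w x t = _ := hwe x t ht
    have e2 : dt w₀ x t = _ := hw₀e x t ht
    change dt W x t = θ / 2 * lapQ W x t - Φ.toFun (F x) * W x t
      + (-(h x * w₀ x t) + 1 / 2 * lapQ U x t)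
    rw [dt_sub hw hw₀, lapQ_sub hw hw₀, lapQ_sub hus hu₀s, e1, e2, hW, hh]
    change θ / 2 * lapQ w x t - _ + 1 / 2 * lapQ u x t
      - (θ / 2 * lapQ w₀ x t - _ + 1 / 2 * lapQ u₀ x t) = _
    ring
  have hfm : ∀ x, Φ.fmin ≤ Φ.toFun (F x) := fun x => (Φ.gt_fmin _).le
  have hgU : Continuous fun p : (Fin d → ℝ) × ℝ => h p.1 * u₀ p.1 p.2 :=
    hhc1.fun_mul hu₀s.continuous
  have hgW : Continuous fun p : (Fin d → ℝ) × ℝ => h p.1 * w₀ p.1 p.2 :=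
    hhc1.fun_mul hw₀.continuous
  have hgW' : Continuous fun p : (Fin d → ℝ) × ℝ =>
      -(h p.1 * w₀ p.1 p.2) + 1 / 2 * lapQ U p.1 p.2 :=
    hgW.fun_neg.fun_add (hUs.lapQ.continuous.const_mul _)
  obtain ⟨-, hLU, -⟩ := hmax θ hθ1 _ hfm hfK _ _ hgU.fun_neg hUsol
  simp only [neg_sq] at hLU
  have hIU := integral_muQ_sq_mul_le hT.le hhc hu₀s
    fun x t ht => (hub x t (Set.Ioc_subset_Icc_self ht)).1
  have hIW := integral_muQ_sq_mul_le hT.le hhc hw₀ hwb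
  have hsplit : ∫ p, (-(h p.1 * w₀ p.1 p.2) + 1 / 2 * lapQ U p.1 p.2) ^ 2 ∂muQ d T
      ≤ 2 * ∫ p, (h p.1 * w₀ p.1 p.2) ^ 2 ∂muQ d T
        + 1 / 2 * ∫ p, lapQ U p.1 p.2 ^ 2 ∂muQ d T := by
    have c1 := (hgW.fun_pow 2).const_mul 2
    have c2 := (hUs.lapQ.continuous.fun_pow 2).const_mul (1 / 2)
    rw [← integral_const_mul, ← integral_const_mul,
      ← integral_add c1.integrable_muQ c2.integrable_muQ]
    refine integral_muQ_mono (hgW'.fun_pow 2) (c1.fun_add c2) fun x t _ => ?_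
    nlinarith [sq_nonneg (h x * w₀ x t + 1 / 2 * lapQ U x t)]
  obtain ⟨h1, h2, h3⟩ := hmax θ hθ1 _ hfm hfK _ _ hgW' hWsol
  have h4 := hh21 T W hWs (hwp.sub hw₀p)
  have hGW : ∫ p, (-(h p.1 * w₀ p.1 p.2) + 1 / 2 * lapQ U p.1 p.2) ^ 2 ∂muQ d T
      ≤ (2 * (T * A ^ 2) + 1 / 2 * (P * (T * B ^ 2))) * S := by
    linarith [mul_le_mul_of_nonneg_left hIU hP]
  have hsq : h21Sq T W ≤ E * l2T (fun x => F x - F₀ x) ^ 2 := by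
    calc h21Sq T W ≤ (2 * N + 2) * P
          * ∫ p, (-(h p.1 * w₀ p.1 p.2) + 1 / 2 * lapQ U p.1 p.2) ^ 2 ∂muQ d T := by
          linarith [mul_le_mul_of_nonneg_left h1 (show 0 ≤ N + 1 by positivity),
            mul_le_mul_of_nonneg_left h2 hN]
      _ ≤ (2 * N + 2) * P * ((2 * (T * A ^ 2) + 1 / 2 * (P * (T * B ^ 2)))
          * (L ^ 2 * l2T (fun x => F x - F₀ x) ^ 2)) := by gcongr; exact hGW.trans (by gcongr)
      _ = E * l2T (fun x => F x - F₀ x) ^ 2 := by rw [hE]; ring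
  have hl0 : 0 ≤ l2T (fun x => F x - F₀ x) := Real.sqrt_nonneg _
  have hsup : 0 ≤ supT F := Real.iSup_nonneg fun _ => abs_nonneg _
  calc h21 T W ≤ √(E * l2T (fun x => F x - F₀ x) ^ 2) := Real.sqrt_le_sqrt hsq
    _ = √E * l2T (fun x => F x - F₀ x) := by rw [Real.sqrt_mul hE0, Real.sqrt_sq hl0]
    _ ≤ (√E + 1) * l2T (fun x => F x - F₀ x) := by gcongr; linarith
    _ ≤ (√E + 1) * l2T (fun x => F x - F₀ x) * (1 + supT F) :=
        le_mul_of_one_le_right (by positivity) (by linarith)
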